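/- arXiv:1702.01799 — 3 statements merged into one kernel-verified Lean document; each statement's English description precedes it below -/
import Mathlib

section
/- Let C be a contour with site set S, and let L be a staircase contour labeling of (C,S) satisfying Assumption 1, in which every left label has its port on C_L and every right label has its port on C_R, no two leaders of L intersect, and no two consecutive labels of L intersect. Then for any two non-consecutive labels of L that lie on the same side (both left labels, or both right labels), their text boxes are disjoint. -/
open scoped Classical
noncomputable section

/-- Points of the Euclidean plane. -/
abbrev Pt : Type := ℝ × ℝ

/-- Cross product of `b - a` with `p - a`; its sign gives the orientation of `p`
relative to the directed line from `a` to `b`. -/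
def cross2 (a b p : Pt) : ℝ := (b.1 - a.1) * (p.2 - a.2) - (b.2 - a.2) * (p.1 - a.1)

/-- `p` lies strictly to the right of the directed line from `a` to `b`. -/
def StrictRightOf (a b p : Pt) : Prop := cross2 a b p < 0

/-- `p` lies strictly to the left of the directed line from `a` to `b`. -/
def StrictLeftOf (a b p : Pt) : Prop := 0 < cross2 a b p

/-- `p` lies on or to the left of the directed line from `a` to `b`. -/
def LeftOrOn (a b p : Pt) : Prop := 0 ≤ cross2 a b p

/-- The line through two points `a` and `b`. -/
def lineThrough (a b : Pt) : Set Pt := {p | cross2 a b p = 0}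

/-- The half-line emanating from `a` through `b`. -/
def halfLine (a b : Pt) : Set Pt := {p | ∃ t : ℝ, 0 ≤ t ∧ p = a + t • (b - a)}

/-- A contour: a compact convex subset of the plane with nonempty interior. -/
structure IsContour (C : Set Pt) : Prop where
  compact : IsCompact C
  convex : Convex ℝ C
  nonempty_interior : (interior C).Nonempty

/-- `t` is a topmost point of `C`. -/
def IsTopmost (C : Set Pt) (t : Pt) : Prop := t ∈ C ∧ ∀ q ∈ C, q.2 ≤ t.2

/-- The left chain of `C`: boundary points of minimal `x`-coordinate among the
points of `C` of the same `y`-coordinate. -/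
def leftChain (C : Set Pt) : Set Pt :=
  {p | p ∈ C ∧ p ∈ frontier C ∧ ∀ q ∈ C, q.2 = p.2 → p.1 ≤ q.1}

/-- The right chain of `C`: boundary points of maximal `x`-coordinate among the
points of `C` of the same `y`-coordinate. -/
def rightChain (C : Set Pt) : Set Pt :=
  {p | p ∈ C ∧ p ∈ frontier C ∧ ∀ q ∈ C, q.2 = p.2 → q.1 ≤ p.1}

/-- The sites are in general position: no three of them are collinear. -/
def GenPos (S : Finset Pt) : Prop :=
  ∀ a ∈ S, ∀ b ∈ S, ∀ c ∈ S, a ≠ b → b ≠ c → a ≠ c →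
    ¬ Collinear ℝ ({a, b, c} : Set Pt)

/-- A label: a site, an axis-parallel closed rectangular text box (given by its
lower-left corner `lo` and upper-right corner `hi`), a port, and an orientation
flag `isLeft` (`true` for a left label, `false` for a right label). -/
structure Label where
  site : Pt
  lo : Pt
  hi : Pt
  port : Pt
  isLeft : Bool

/-- The text box of a label, as a point set. -/
def Label.box (ℓ : Label) : Set Pt := Set.Icc ℓ.lo ℓ.hi

/-- The leader of a label: the closed segment from its site to its port. -/
def Label.leader (ℓ : Label) : Set Pt := segment ℝ ℓ.site ℓ.port

/-- A label as a point set: the union of its text box and its leader. -/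
def Label.toSet (ℓ : Label) : Set Pt := ℓ.box ∪ ℓ.leader

/-- A valid label with respect to a contour `C`: nondegenerate box whose interior
is disjoint from `C`, port on the boundary of `C` and on the right (resp. left)
edge of the text box for a left (resp. right) label (criterion T4), and leader
contained in `C`. -/
structure IsLabel (C : Set Pt) (ℓ : Label) : Prop where
  lo_le_hi : ℓ.lo ≤ ℓ.hi
  box_out : interior ℓ.box ∩ C = ∅
  port_bd : ℓ.port ∈ frontier C
  leader_in : ℓ.leader ⊆ C
  left_ok : ℓ.isLeft = true → ℓ.port.1 = ℓ.hi.1 ∧ ℓ.port.2 ∈ Set.Icc ℓ.lo.2 ℓ.hi.2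
  right_ok : ℓ.isLeft = false → ℓ.port.1 = ℓ.lo.1 ∧ ℓ.port.2 ∈ Set.Icc ℓ.lo.2 ℓ.hi.2

/-- The baseline of a label: the horizontal half-line emanating from the
bottom/top outer corner of the text box, away from the figure; a label is a top
label if the `y`-coordinate of its port is at least that of its site. -/
def Label.baseline (ℓ : Label) : Set Pt :=
  if ℓ.isLeft then
    (if ℓ.site.2 ≤ ℓ.port.2 then {p : Pt | p.2 = ℓ.hi.2 ∧ p.1 ≤ ℓ.lo.1}
     else {p : Pt | p.2 = ℓ.lo.2 ∧ p.1 ≤ ℓ.lo.1})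
  else
    (if ℓ.site.2 ≤ ℓ.port.2 then {p : Pt | p.2 = ℓ.hi.2 ∧ ℓ.hi.1 ≤ p.1}
     else {p : Pt | p.2 = ℓ.lo.2 ∧ ℓ.hi.1 ≤ p.1})

/-- Every left label has its port on the left chain and every right label has
its port on the right chain. -/
def PortsOnChains (C : Set Pt) (L : List Label) : Prop :=
  ∀ ℓ ∈ L, (ℓ.isLeft = true → ℓ.port ∈ leftChain C) ∧
           (ℓ.isLeft = false → ℓ.port ∈ rightChain C)

/-- `ChainPortOK C ℓ`: the port of `ℓ` lies on the chain matching its side. -/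
def ChainPortOK (C : Set Pt) (ℓ : Label) : Prop :=
  (ℓ.isLeft = true → ℓ.port ∈ leftChain C) ∧ (ℓ.isLeft = false → ℓ.port ∈ rightChain C)

/-- Clockwise order (from the topmost point) of two boundary points of `C` that
lie on its chains: the right chain is traversed top-down before the left chain
is traversed bottom-up. -/
def CwLT (C : Set Pt) (p q : Pt) : Prop :=
  (p ∈ rightChain C ∧ q ∈ rightChain C ∧ q.2 < p.2) ∨
  (p ∈ rightChain C ∧ q ∈ leftChain C ∧ q ∉ rightChain C) ∨
  (p ∉ rightChain C ∧ p ∈ leftChain C ∧ q ∈ leftChain C ∧ q ∉ rightChain C ∧ p.2 < q.2)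

/-- A list of labels is in radial order if consecutive list entries have ports in
clockwise order along the boundary of `C`. -/
def InRadialOrder (C : Set Pt) (L : List Label) : Prop :=
  L.Chain' (fun a b => CwLT C a.port b.port)

/-- A contour labeling of `(C, S)`, represented as the list of its labels in
radial order: exactly one valid label for each site of `S`. -/
structure IsContourLabeling (C : Set Pt) (S : Finset Pt) (L : List Label) : Prop where
  valid : ∀ ℓ ∈ L, IsLabel C ℓ
  nodup_sites : (L.map Label.site).Nodup
  sites_iff : ∀ s : Pt, s ∈ S ↔ s ∈ L.map Label.site
  radial : InRadialOrder C L

/-- A labeling is planar if its labels are pairwise disjoint point sets. -/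
def PlanarList (L : List Label) : Prop :=
  L.Pairwise (fun a b => a.toSet ∩ b.toSet = ∅)

/-- Two labels are consecutive in the cyclic radial ordering. -/
def Consecutive (L : List Label) (a b : Label) : Prop :=
  (a, b) ∈ L.zip (L.rotate 1) ∨ (b, a) ∈ L.zip (L.rotate 1)

/-- Staircase property (criterion T5): no label intersects the baseline of a
consecutive label. -/
def IsStaircase (L : List Label) : Prop :=
  ∀ a b, Consecutive L a b → a.toSet ∩ b.baseline = ∅ ∧ b.toSet ∩ a.baseline = ∅

/-- Assumption 1: no text box of any label intersects the convex hull of the sites. -/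
def Assumption1 (S : Finset Pt) (L : List Label) : Prop :=
  ∀ ℓ ∈ L, ℓ.box ∩ convexHull ℝ (S : Set Pt) = ∅

/-- No two leaders of the labeling intersect. -/
def LeadersDisjoint (L : List Label) : Prop :=
  L.Pairwise (fun a b => a.leader ∩ b.leader = ∅)

/-- No two consecutive labels of the labeling intersect. -/
def ConsecutiveDisjoint (L : List Label) : Prop :=
  ∀ a b, Consecutive L a b → a ≠ b → a.toSet ∩ b.toSet = ∅

/-- The (open) path cost of a list of labels:
`Σ c1(ℓ_i) + Σ c2(ℓ_i, ℓ_{i+1})` over consecutive pairs of the list. -/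
def pathCost (c1 : Label → ℝ) (c2 : Label → Label → ℝ) (L : List Label) : ℝ :=
  (L.map c1).sum + (List.zipWith c2 L L.tail).sum

/-- The cyclic cost of a labeling:
`Σ_{i=1}^n ( c1(ℓ_i) + c2(ℓ_i, ℓ_{i+1}) )` with `ℓ_{n+1} = ℓ_1`. -/
def cycCost (c1 : Label → ℝ) (c2 : Label → Label → ℝ) (L : List Label) : ℝ :=
  (L.map c1).sum + (List.zipWith c2 L (L.rotate 1)).sum

/-- The polyline through a list of points, as a point set. -/
def polyline : List Pt → Set Pt
  | [] => ∅
  | [a] => {a}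
  | a :: b :: r => segment ℝ a b ∪ polyline (b :: r)

/-- A convex chain `(s_1, …, s_k)`: at least two pairwise distinct points that
appear in this order on the boundary of their convex hull (the hull lies to the
left of each directed edge), the interior points lying strictly to the right of
the directed line from `s_1` to `s_k`. -/
def IsConvexChain (K : List Pt) : Prop :=
  2 ≤ K.length ∧ K.Nodup ∧
  (∀ ab ∈ K.zip K.tail, ∀ p ∈ K, LeftOrOn ab.1 ab.2 p) ∧
  (∀ p ∈ K, LeftOrOn K.getLast! K.head! p) ∧
  (∀ s ∈ (K.drop 1).dropLast, StrictRightOf K.head! K.getLast! s)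

/-- A (candidate) sub-instance, given by its separator: the two fixed labels
`la` and `lb` and the convex chain `K` from the site of `la` to the site of `lb`. -/
structure SubInstance where
  la : Label
  lb : Label
  K : List Pt

namespace SubInstance

/-- The separator `K' = (p_1, s_1, …, s_k, p_k)` as a point set. -/
def sepSet (J : SubInstance) : Set Pt :=
  J.la.leader ∪ polyline J.K ∪ J.lb.leader

/-- The interior sites `s_2, …, s_{k-1}` of the chain of the separator. -/
def innerSites (J : SubInstance) : Set Pt := {p | p ∈ (J.K.drop 1).dropLast}

/-- The region `C'` of the sub-instance: the part of `C` cut off by the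
separator that does not contain the topmost point `t`. -/
def region (C : Set Pt) (t : Pt) (J : SubInstance) : Set Pt :=
  C \ connectedComponentIn (C \ J.sepSet) t

/-- The region `C''`: the closed part of `C` on the side of the separator that
contains the topmost point `t` (the concave counterpart). -/
def regionTop (C : Set Pt) (t : Pt) (J : SubInstance) : Set Pt :=
  C ∩ closure (connectedComponentIn (C \ J.sepSet) t)

/-- The sites belonging to the sub-instance: the sites of `S` in its region,
other than the sites of the two separator labels. -/
def sites (C : Set Pt) (t : Pt) (S : Finset Pt) (J : SubInstance) : Set Pt :=
  {s | s ∈ (S : Set Pt) ∧ s ∈ J.region C t ∧ s ≠ J.la.site ∧ s ≠ J.lb.site}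

/-- Region `A_1` of the concave part `C''`: the part of `C''` strictly to the
left of the line from `s_1` to `s_k` that is adjacent to the leader of `la`. -/
def A1 (C : Set Pt) (t : Pt) (J : SubInstance) : Set Pt :=
  {p | p ∈ J.regionTop C t ∧ StrictLeftOf J.la.site J.lb.site p ∧
    (closure (connectedComponentIn
        (J.regionTop C t ∩ {q | StrictLeftOf J.la.site J.lb.site q}) p)
      ∩ J.la.leader).Nonempty}

/-- Region `A_3` of the concave part `C''`: the part of `C''` strictly to the
left of the line from `s_1` to `s_k` that is adjacent to the leader of `lb`. -/
def A3 (C : Set Pt) (t : Pt) (J : SubInstance) : Set Pt :=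
  {p | p ∈ J.regionTop C t ∧ StrictLeftOf J.la.site J.lb.site p ∧
    (closure (connectedComponentIn
        (J.regionTop C t ∩ {q | StrictLeftOf J.la.site J.lb.site q}) p)
      ∩ J.lb.leader).Nonempty}

/-- Region `A_2` of the concave part `C''`: the part strictly to the right of
the line from `s_1` to `s_k`. -/
def A2 (C : Set Pt) (t : Pt) (J : SubInstance) : Set Pt :=
  {p | p ∈ J.regionTop C t ∧ StrictRightOf J.la.site J.lb.site p}

/-- For a capstone instance: the part `A_1` of the region of the instance
strictly to the right of the line from `s_1` to `s_2`, adjacent to the leader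
of `la`. -/
def A1cap (C : Set Pt) (t : Pt) (J : SubInstance) : Set Pt :=
  {p | p ∈ J.region C t ∧ StrictRightOf J.la.site J.lb.site p ∧
    (closure (connectedComponentIn
        (J.region C t ∩ {q | StrictRightOf J.la.site J.lb.site q}) p)
      ∩ J.la.leader).Nonempty}

/-- For a capstone instance: the part `A_3` of the region of the instance
strictly to the right of the line from `s_1` to `s_2`, adjacent to the leader
of `lb`. -/
def A3cap (C : Set Pt) (t : Pt) (J : SubInstance) : Set Pt :=
  {p | p ∈ J.region C t ∧ StrictRightOf J.la.site J.lb.site p ∧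
    (closure (connectedComponentIn
        (J.region C t ∩ {q | StrictRightOf J.la.site J.lb.site q}) p)
      ∩ J.lb.leader).Nonempty}

/-- For a capstone instance: the part `A_2` of the region of the instance
strictly to the left of the line from `s_1` to `s_2`. -/
def A2cap (C : Set Pt) (t : Pt) (J : SubInstance) : Set Pt :=
  {p | p ∈ J.region C t ∧ StrictLeftOf J.la.site J.lb.site p}

end SubInstance

/-- Well-formedness of a separator: the two labels are valid, satisfy T4 with
ports on the correct chains, are disjoint, the chain is convex and runs from the
site of `la` to the site of `lb`, and the port of `la` is met before the port
of `lb` when traversing the boundary clockwise from the topmost point. -/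
structure IsSeparator (C : Set Pt) (t : Pt) (J : SubInstance) : Prop where
  la_valid : IsLabel C J.la
  lb_valid : IsLabel C J.lb
  la_chain : ChainPortOK C J.la
  lb_chain : ChainPortOK C J.lb
  disj : J.la.toSet ∩ J.lb.toSet = ∅
  chain : IsConvexChain J.K
  head_eq : J.K.head? = some J.la.site
  last_eq : J.K.getLast? = some J.lb.site
  order : CwLT C J.la.port J.lb.port

/-- A label is contained in a sub-instance if its leader lies in the region of
the sub-instance and meets the separator at most in the interior chain sites,
and its port lies on the part of the boundary of `C` belonging to the
sub-instance. -/
def ContainedIn (C : Set Pt) (t : Pt) (J : SubInstance) (ℓ : Label) : Prop :=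
  ℓ.leader ⊆ J.region C t ∧
  ℓ.leader ∩ J.sepSet ⊆ J.innerSites ∧
  ℓ.port ∈ frontier C ∧ ℓ.port ∈ J.region C t

/-- The restriction `L|J` of a radially ordered labeling `L` to a sub-instance
`J`: the labels of `L` contained in `J`, together with the two separator labels
of `J`, in radial order. -/
def restrict (C : Set Pt) (t : Pt) (L : List Label) (J : SubInstance) : List Label :=
  J.la :: (L.filter (fun ℓ => decide (ContainedIn C t J ℓ)) ++ [J.lb])

/-- A planar labeling of a convex instance `J`: the two fixed separator labels
(first and last in radial order) together with exactly one label for each site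
of the instance, pairwise disjoint, each contained in the instance. -/
structure IsInstanceLabeling (C : Set Pt) (t : Pt) (S : Finset Pt)
    (J : SubInstance) (L : List Label) : Prop where
  sep : IsSeparator C t J
  head_eq : L.head? = some J.la
  last_eq : L.getLast? = some J.lb
  valid : ∀ ℓ ∈ L, IsLabel C ℓ
  contained : ∀ ℓ ∈ L, ℓ ≠ J.la → ℓ ≠ J.lb → ContainedIn C t J ℓ
  nodup_sites : (L.map Label.site).Nodup
  sites_iff : ∀ s : Pt, s ∈ J.sites C t S ↔ ∃ ℓ ∈ L, ℓ ≠ J.la ∧ ℓ ≠ J.lb ∧ ℓ.site = s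
  planar : PlanarList L
  radial : InRadialOrder C L

/-- `W` separates `A` from `B` inside the ambient set `amb`: no connected subset
of `amb \ W` meets both `A` and `B`. -/
def SeparatesIn (amb W A B : Set Pt) : Prop :=
  ∀ a ∈ A \ W, ∀ b ∈ B \ W, b ∉ connectedComponentIn (amb \ W) a

/-- The convex instance `J` has type A with support point `s`: `s` is a site in
region `A_1` such that the label `la` together with the half-line emanating from
`s` through the site of `la` separates the chain `K` from the sites in the
concave part `C''`. -/
def IsTypeA (C : Set Pt) (t : Pt) (S : Finset Pt) (J : SubInstance) (s : Pt) : Prop :=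
  s ∈ (S : Set Pt) ∧ s ∈ J.A1 C t ∧
  SeparatesIn C (J.la.toSet ∪ halfLine s J.la.site)
    {p | p ∈ J.K} ((S : Set Pt) ∩ J.regionTop C t)

/-- The convex instance `J` has type B with support point `s`: `s` is a site in
region `A_3` such that the label `lb` together with the half-line emanating from
`s` through the site of `lb` separates the chain `K` from the sites in the
concave part `C''`. -/
def IsTypeB (C : Set Pt) (t : Pt) (S : Finset Pt) (J : SubInstance) (s : Pt) : Prop :=
  s ∈ (S : Set Pt) ∧ s ∈ J.A3 C t ∧
  SeparatesIn C (J.lb.toSet ∪ halfLine s J.lb.site)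
    {p | p ∈ J.K} ((S : Set Pt) ∩ J.regionTop C t)

/-- The concave part `C''` of the instance contains no sites (besides the chain
sites themselves); this is the case of support point `⊥`. -/
def ConcaveEmpty (C : Set Pt) (t : Pt) (S : Finset Pt) (J : SubInstance) : Prop :=
  (S : Set Pt) ∩ J.regionTop C t ⊆ {p | p ∈ J.K}

/-- A capstone instance: the chain consists only of the two separator sites. -/
def IsCapstone (J : SubInstance) : Prop :=
  J.K = [J.la.site, J.lb.site]

/-- Two sub-instances are disjoint if the interiors of their regions are disjoint. -/
def InstancesDisjoint (C : Set Pt) (t : Pt) (J J' : SubInstance) : Prop :=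
  interior (J.region C t) ∩ interior (J'.region C t) = ∅

end


structure RL where
  s : Pt
  p : Pt
  l : ℝ
  u : ℝ
  w : ℝ
  top : Bool

def RL.h (a : RL) : ℝ := if a.top then a.u else a.l

def RL.In (a : RL) (z : Pt) : Prop :=
  a.p.1 ≤ z.1 ∧ z.1 ≤ a.w ∧ a.l ≤ z.2 ∧ z.2 ≤ a.u

structure RL.Ok (C : Set Pt) (a : RL) : Prop where
  sC : a.s ∈ C
  pC : a.p ∈ C
  ch : ∀ q ∈ C, q.2 = a.p.2 → q.1 ≤ a.p.1
  l_le : a.l ≤ a.p.2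
  le_u : a.p.2 ≤ a.u
  le_w : a.p.1 ≤ a.w
  out : ∀ q ∈ C, a.p.1 < q.1 → q.1 < a.w → a.l < q.2 → q.2 < a.u → False
  ht : a.top = true → a.s.2 ≤ a.p.2
  hb : a.top = false → a.p.2 ≤ a.s.2

structure HP (a b : RL) : Prop where
  disj : ∀ z, a.In z → b.In z → False
  lead : ∀ z ∈ segment ℝ a.s a.p, b.In z → False
  base : ∀ z, a.In z → z.2 = b.h → b.w ≤ z.1 → False
  lbase : ∀ z ∈ segment ℝ a.s a.p, z.2 = b.h → b.w ≤ z.1 → False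
  hull : ∀ z ∈ segment ℝ a.s b.s, b.In z → False

def RL.flip (a : RL) : RL :=
  ⟨(a.s.1, -a.s.2), (a.p.1, -a.p.2), -a.u, -a.l, a.w, !a.top⟩

def flY (q : Pt) : Pt := (q.1, -q.2)

def fY (C : Set Pt) : Set Pt := {q | flY q ∈ C}

lemma flY_flY (q : Pt) : flY (flY q) = q := by simp [flY]

lemma RL.flip_h (a : RL) : a.flip.h = -a.h := by
  unfold RL.h RL.flip
  cases a.top <;> simp

lemma RL.flip_In (a : RL) (z : Pt) : a.flip.In z ↔ a.In (flY z) := by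
  unfold RL.In RL.flip flY
  simp only
  constructor <;> rintro ⟨h1, h2, h3, h4⟩ <;> refine ⟨h1, h2, by linarith, by linarith⟩

lemma seg_flY {a b z : Pt} (h : z ∈ segment ℝ (flY a) (flY b)) : flY z ∈ segment ℝ a b := by
  obtain ⟨x, y, hx, hy, hxy, rfl⟩ := h
  refine ⟨x, y, hx, hy, hxy, ?_⟩
  ext <;> simp [flY] <;> ring

lemma fY_convex {C : Set Pt} (hC : Convex ℝ C) : Convex ℝ (fY C) := by
  intro a ha b hb x y hx hy hxy
  have := hC ha hb hx hy hxy
  unfold fY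
  simp only [Set.mem_setOf_eq]
  convert this using 1
  ext <;> simp [flY] <;> ring

lemma RL.Ok.flip {C : Set Pt} {a : RL} (h : a.Ok C) : a.flip.Ok (fY C) := by
  refine ⟨?_, ?_, ?_, ?_, ?_, ?_, ?_, ?_, ?_⟩
  · simpa [fY, flY, RL.flip] using h.sC
  · simpa [fY, flY, RL.flip] using h.pC
  · intro q hq h2
    exact h.ch (flY q) hq (by simp only [flY, RL.flip] at h2 ⊢; linarith)
  · simpa [RL.flip] using h.le_u
  · simpa [RL.flip] using h.l_le
  · simpa [RL.flip] using h.le_w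
  · intro q hq h1 h2 h3 h4
    simp only [RL.flip] at h1 h2 h3 h4
    exact h.out (flY q) hq h1 h2 (by simp only [flY]; linarith) (by simp only [flY]; linarith)
  · intro ht
    have := h.hb (by simpa [RL.flip] using ht)
    simpa [RL.flip] using this
  · intro ht
    have := h.ht (by simpa [RL.flip] using ht)
    simpa [RL.flip] using this

lemma HP.flip {a b : RL} (h : HP a b) : HP a.flip b.flip := by
  refine ⟨?_, ?_, ?_, ?_, ?_⟩
  · intro z h1 h2
    exact h.disj _ ((RL.flip_In _ _).1 h1) ((RL.flip_In _ _).1 h2)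
  · intro z h1 h2
    exact h.lead _ (seg_flY h1) ((RL.flip_In _ _).1 h2)
  · intro z h1 h2 h3
    refine h.base _ ((RL.flip_In _ _).1 h1) ?_ h3
    rw [RL.flip_h] at h2
    simp [flY, h2]
  · intro z h1 h2 h3
    refine h.lbase _ (seg_flY h1) ?_ h3
    rw [RL.flip_h] at h2
    simp [flY, h2]
  · intro z h1 h2
    exact h.hull _ (seg_flY h1) ((RL.flip_In _ _).1 h2)

/-- crossing a horizontal line -/
lemma segY (A B : Pt) (y : ℝ) (h1 : A.2 ≤ y) (h2 : y ≤ B.2) (h : A.2 < B.2) :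
    ∃ z ∈ segment ℝ A B, z.2 = y ∧
      z.1 * (B.2 - A.2) = A.1 * (B.2 - y) + B.1 * (y - A.2) := by
  have hd : 0 < B.2 - A.2 := by linarith
  refine ⟨((B.2 - y) / (B.2 - A.2)) • A + ((y - A.2) / (B.2 - A.2)) • B,
    ⟨_, _, div_nonneg (by linarith) hd.le, div_nonneg (by linarith) hd.le, ?_, rfl⟩, ?_, ?_⟩
  · field_simp; ring
  · simp; field_simp; ring
  · simp; field_simp

/-- crossing a vertical line -/
lemma segX (A B : Pt) (x : ℝ) (h1 : A.1 ≤ x) (h2 : x ≤ B.1) (h : A.1 < B.1) :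
    ∃ z ∈ segment ℝ A B, z.1 = x ∧
      z.2 * (B.1 - A.1) = A.2 * (B.1 - x) + B.2 * (x - A.1) := by
  have hd : 0 < B.1 - A.1 := by linarith
  refine ⟨((B.1 - x) / (B.1 - A.1)) • A + ((x - A.1) / (B.1 - A.1)) • B,
    ⟨_, _, div_nonneg (by linarith) hd.le, div_nonneg (by linarith) hd.le, ?_, rfl⟩, ?_, ?_⟩
  · field_simp; ring
  · simp; field_simp; ring
  · simp; field_simp

lemma seg_sub {A B G : Pt} (hG : G ∈ segment ℝ A B) {z : Pt} (hz : z ∈ segment ℝ G B) :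
    z ∈ segment ℝ A B :=
  (convex_segment A B).segment_subset hG (right_mem_segment ℝ A B) hz

lemma N1 {C : Set Pt} (hC : Convex ℝ C) {p A B : Pt}
    (ch : ∀ q ∈ C, q.2 = p.2 → q.1 ≤ p.1) (hA : A ∈ C) (hB : B ∈ C)
    (a1 : p.1 ≤ A.1) (b1 : p.1 < B.1) (a2 : A.2 < p.2) (b2 : p.2 ≤ B.2) : False := by
  obtain ⟨z, hz, hz2, hz1⟩ := segY A B p.2 a2.le b2 (by linarith)
  have := ch z (hC.segment_subset hA hB hz) hz2
  nlinarith [mul_nonneg (sub_nonneg.2 a1) (sub_nonneg.2 b2), mul_pos (sub_pos.2 b1) (sub_pos.2 a2),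
    mul_nonneg (sub_nonneg.2 this) (by linarith : (0:ℝ) ≤ B.2 - A.2)]

lemma N2 {C : Set Pt} (hC : Convex ℝ C) {p A B : Pt}
    (ch : ∀ q ∈ C, q.2 = p.2 → q.1 ≤ p.1) (hA : A ∈ C) (hB : B ∈ C)
    (a1 : p.1 < A.1) (b1 : p.1 ≤ B.1) (a2 : A.2 ≤ p.2) (b2 : p.2 < B.2) : False := by
  obtain ⟨z, hz, hz2, hz1⟩ := segY A B p.2 a2 b2.le (by linarith)
  have := ch z (hC.segment_subset hA hB hz) hz2
  nlinarith [mul_pos (sub_pos.2 a1) (sub_pos.2 b2), mul_nonneg (sub_nonneg.2 b1) (sub_nonneg.2 a2),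
    mul_nonneg (sub_nonneg.2 this) (by linarith : (0:ℝ) ≤ B.2 - A.2)]

/-- positive width boxes are to the right of `C` -/
lemma Fpos {C : Set Pt} (hC : Convex ℝ C) {a : RL} (ha : a.Ok C) (hw : a.p.1 < a.w)
    {q : Pt} (hq : q ∈ C) (h1 : a.l ≤ q.2) (h2 : q.2 ≤ a.u) : q.1 ≤ a.p.1 := by
  by_contra hlt
  push Not at hlt
  obtain ⟨x, hx1, hx2⟩ := exists_between (lt_min hlt hw)
  obtain ⟨z, hz, hz1, hz2⟩ := segX a.p q x hx1.le (hx2.le.trans (min_le_left _ _)) hlt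
  have hxq := hx2.trans_le (min_le_left _ _)
  have hxw := hx2.trans_le (min_le_right _ _)
  have hzC := hC.segment_subset ha.pC hq hz
  have hl := ha.l_le
  have hu := ha.le_u
  have hd : 0 < q.1 - a.p.1 := by linarith
  have e1 := sub_pos.2 hx1
  have e2 := sub_pos.2 hxq
  rcases lt_trichotomy q.2 a.p.2 with h | h | h
  · refine ha.out z hzC (by linarith) (by linarith) ?_ ?_
    · by_contra hc; push Not at hc
      nlinarith [mul_pos e2 (sub_pos.2 (lt_of_le_of_lt h1 h))]
    · by_contra hc; push Not at hc
      nlinarith [mul_pos e1 (sub_pos.2 (lt_of_lt_of_le h hu))]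
  · linarith [ha.ch q hq h]
  · refine ha.out z hzC (by linarith) (by linarith) ?_ ?_
    · by_contra hc; push Not at hc
      nlinarith [mul_pos e1 (sub_pos.2 (lt_of_le_of_lt hl h))]
    · by_contra hc; push Not at hc
      nlinarith [mul_pos e2 (sub_pos.2 (lt_of_lt_of_le h h2))]

lemma Y1 {C : Set Pt} (hC : Convex ℝ C) {b : RL} (hb : b.Ok C) {T T' : Pt} (hT : T ∈ C)
    (hT' : T' ∈ C) (h1 : T.2 ≤ b.p.2) (h2 : b.p.1 < T'.1) (h3 : b.p.2 < T'.2) (h4 : T'.2 ≤ b.u) :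
    ∃ z ∈ segment ℝ T T', b.In z := by
  obtain ⟨G, hG, hG2, -⟩ := segY T T' b.p.2 h1 h3.le (by linarith)
  have hG1 := hb.ch G (hC.segment_subset hT hT' hG) hG2
  obtain ⟨z, hz, hz1, hz2⟩ := segX G T' b.p.1 hG1 h2.le (by linarith)
  refine ⟨z, seg_sub hG hz, hz1.ge, hz1.le.trans hb.le_w, ?_, ?_⟩
  · refine hb.l_le.trans ?_
    by_contra hc; push Not at hc
    nlinarith [mul_nonneg (sub_nonneg.2 h3.le) (sub_nonneg.2 hG1)]
  · refine le_trans ?_ h4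
    by_contra hc; push Not at hc
    nlinarith [mul_nonneg (sub_nonneg.2 h3.le) (sub_nonneg.2 h2.le)]

lemma lemY {C : Set Pt} (hC : Convex ℝ C) {a b : RL} (ha : a.Ok C) (hb : b.Ok C) (hp : HP a b)
    (hw : b.w = b.p.1) (ht : b.top = true) (h1 : b.p.1 < a.p.1) (h2 : b.p.2 < a.p.2)
    (h3 : a.p.2 < b.u) : False := by
  have hh : b.h = b.u := by simp [RL.h, ht]
  have s1 : b.p.2 < a.s.2 := by
    by_contra hc; push Not at hc
    obtain ⟨z, hz, hi⟩ := Y1 hC hb ha.sC ha.pC hc h1 h2 h3.le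
    exact hp.lead z hz hi
  have key : ∀ G ∈ segment ℝ a.s a.p, b.p.1 ≤ G.1 → b.u ≤ G.2 → False := by
    intro G hG g1 g2
    obtain ⟨z, hz, hz2, hz1⟩ := segY a.p G b.u h3.le g2 (by linarith)
    rw [segment_symm] at hz
    refine hp.lbase z (seg_sub hG hz) (hz2.trans hh.symm) ?_
    rw [hw]
    by_contra hc; push Not at hc
    nlinarith [mul_nonneg (sub_nonneg.2 h1.le) (sub_nonneg.2 g2), mul_nonneg (sub_nonneg.2 g1) (sub_nonneg.2 h3.le)]
  have s2 : b.p.1 < a.s.1 := by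
    by_contra hc; push Not at hc
    obtain ⟨z, hz, hz1, hz2⟩ := segX a.s a.p b.p.1 hc h1.le (by linarith)
    have : b.p.2 ≤ z.2 := by
      by_contra hcc; push Not at hcc
      nlinarith [mul_nonneg (sub_nonneg.2 h2.le) (sub_nonneg.2 hc), mul_nonneg (sub_nonneg.2 s1.le) (sub_nonneg.2 h1.le)]
    by_cases hu : z.2 ≤ b.u
    · exact hp.lead z hz ⟨hz1.ge, hz1.le.trans hb.le_w, hb.l_le.trans this, hu⟩
    · exact key z hz hz1.ge (by linarith)
  have s3 : a.s.2 < b.u := by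
    by_contra hc; push Not at hc
    exact key a.s (left_mem_segment ℝ _ _) s2.le hc
  obtain ⟨z, hz, hi⟩ := Y1 hC hb hb.sC ha.sC (hb.ht ht) s2 s1 s3.le
  rw [segment_symm] at hz
  exact hp.hull z hz hi

/-- "below the label" -/
def RL.D (a : RL) (z : Pt) : Prop := (a.p.1 ≤ z.1 ∧ z.2 < a.h) ∨ (z.1 < a.p.1 ∧ z.2 < a.p.2)
def RL.U (a : RL) (z : Pt) : Prop := (a.p.1 ≤ z.1 ∧ a.h < z.2) ∨ (z.1 < a.p.1 ∧ a.p.2 < z.2)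

lemma RL.flip_D (a : RL) (z : Pt) : a.flip.D z ↔ a.U (flY z) := by
  unfold RL.D RL.U
  rw [RL.flip_h]
  simp only [RL.flip, flY]
  constructor
  · rintro (⟨h, h'⟩ | ⟨h, h'⟩)
    · exact Or.inl ⟨h, by linarith⟩
    · exact Or.inr ⟨h, by linarith⟩
  · rintro (⟨h, h'⟩ | ⟨h, h'⟩)
    · exact Or.inl ⟨h, by linarith⟩
    · exact Or.inr ⟨h, by linarith⟩

lemma RL.DU (a : RL) (z : Pt) (h : a.D z) (h' : a.U z) : False := by
  rcases h with ⟨h1, h2⟩ | ⟨h1, h2⟩ <;> rcases h' with ⟨h3, h4⟩ | ⟨h3, h4⟩ <;> linarith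

lemma RL.Ok.hcases {C : Set Pt} {a : RL} (ha : a.Ok C) : (a.top = true ∧ a.h = a.u) ∨
    (a.top = false ∧ a.h = a.l) := by
  unfold RL.h
  cases a.top <;> simp

lemma claim1 {C : Set Pt} (hC : Convex ℝ C) {a b : RL} (ha : a.Ok C) (hb : b.Ok C)
    (hab : HP a b) (hba : HP b a) (hy : b.p.2 < a.p.2) {z : Pt} (hz : b.In z)
    (hr : b.w = b.p.1 → b.top = false → b.p.1 < a.p.1 → z.2 ≤ b.p.2) : a.D z := by
  have hal := ha.l_le
  have hau := ha.le_u
  have haw := ha.le_w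
  have hbl := hb.l_le
  have hbu := hb.le_u
  have hbw := hb.le_w
  obtain ⟨z1, z2, z3, z4⟩ := hz
  by_contra hD
  by_cases hx : a.p.1 ≤ z.1
  · have hzh : a.h ≤ z.2 := by
      by_contra hc; exact hD (Or.inl ⟨hx, by linarith⟩)
    have hhr : a.l ≤ a.h ∧ a.h ≤ a.u := by
      rcases ha.hcases with ⟨-, h⟩ | ⟨-, h⟩ <;> constructor <;> linarith
    have hbl' : a.h < b.l := by
      by_contra hc; push Not at hc
      have hin : b.In (z.1, a.h) := ⟨z1, z2, hc, by simp only; linarith⟩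
      by_cases hzw : z.1 ≤ a.w
      · exact hab.disj (z.1, a.h) ⟨hx, hzw, hhr.1, hhr.2⟩ hin
      · exact hba.base (z.1, a.h) hin rfl (by simp only; linarith)
    rcases ha.hcases with ⟨ht, hh⟩ | ⟨ht, hh⟩
    · linarith
    · by_cases hxx : b.p.1 ≤ a.p.1
      · exact hab.disj (a.p.1, b.p.2) ⟨le_rfl, haw, by simp only; linarith, by simp only; linarith⟩
          ⟨hxx, by simp only; linarith, hbl, hbu⟩
      · push Not at hxx
        rcases haw.lt_or_eq with hw | hw
        · linarith [Fpos hC ha hw hb.pC (by linarith) (by linarith)]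
        · refine lemY (fY_convex hC) hb.flip ha.flip hba.flip ?_ ?_ ?_ ?_ ?_
          · simp [RL.flip, hw]
          · simp [RL.flip, ht]
          · simpa [RL.flip] using hxx
          · simpa [RL.flip] using hy
          · simp only [RL.flip]; linarith
  · push Not at hx
    have hzp : a.p.2 ≤ z.2 := by
      by_contra hc; exact hD (Or.inr ⟨hx, by linarith⟩)
    have hwa : b.w < a.p.1 := by
      by_contra hc; push Not at hc
      exact hab.disj a.p ⟨le_rfl, haw, hal, hau⟩ ⟨by linarith, hc, by linarith, by linarith⟩
    rcases hbw.lt_or_eq with hw | hw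
    · linarith [Fpos hC hb hw ha.pC (by linarith) (by linarith)]
    · rcases hb.hcases with ⟨ht, hh⟩ | ⟨ht, hh⟩
      · rcases (show a.p.2 ≤ b.u by linarith).lt_or_eq with h | h
        · exact lemY hC ha hb hab hw.symm ht (by linarith) hy h
        · exact hab.lbase a.p (right_mem_segment ℝ _ _) (by rw [hh, h]) hwa.le
      · linarith [hr hw.symm ht (by linarith)]

lemma claim2 {C : Set Pt} {a b : RL} (ha : a.Ok C) (hb : b.Ok C)
    (hab : HP a b) (hy : b.p.2 < a.p.2)
    (h1 : ∀ z, b.In z → (z.2 = b.h ∨ z.2 = b.p.2) → a.D z) {z : Pt} (hz : b.D z) : a.D z := by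
  have hal := ha.l_le
  have hau := ha.le_u
  have haw := ha.le_w
  have hbl := hb.l_le
  have hbu := hb.le_u
  have hbw := hb.le_w
  have hhr : b.l ≤ b.h ∧ b.h ≤ b.u := by
      rcases hb.hcases with ⟨-, h⟩ | ⟨-, h⟩ <;> constructor <;> linarith
  have c1 := h1 (b.p.1, b.h) ⟨le_rfl, hbw, hhr.1, hhr.2⟩ (Or.inl rfl)
  have c2 := h1 (b.w, b.h) ⟨hbw, le_rfl, hhr.1, hhr.2⟩ (Or.inl rfl)
  have c3 := h1 b.p ⟨le_rfl, hbw, hbl, hbu⟩ (Or.inr rfl)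
  have hh : b.h < a.h := by
    rcases c2 with ⟨_, c⟩ | ⟨c', c⟩
    · exact c
    · simp only at c c'
      rcases ha.hcases with ⟨ht, hh⟩ | ⟨ht, hh⟩
      · linarith
      · by_contra hc; push Not at hc
        exact hab.base (a.p.1, b.h) ⟨le_rfl, haw, by simp only; linarith, by simp only; linarith⟩ rfl c'.le
  unfold RL.D at c1 c3 hz ⊢
  simp only at c1 c3
  by_cases hx : a.p.1 ≤ z.1
  · left
    refine ⟨hx, ?_⟩
    rcases hz with ⟨h, h'⟩ | ⟨h, h'⟩
    · linarith
    · rcases c3 with ⟨c, c'⟩ | ⟨c, c'⟩ <;> linarith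
  · right
    push Not at hx
    refine ⟨hx, ?_⟩
    rcases hz with ⟨h, h'⟩ | ⟨h, h'⟩
    · rcases c1 with ⟨c, c'⟩ | ⟨c, c'⟩ <;> linarith
    · linarith

lemma segCrossL {P Q : Pt} {x0 yn ym : ℝ} (hP : P.1 < x0) (hQ : Q.1 < x0) (hy : ym < yn)
    (h1 : cross2 P Q (x0, yn) ≤ 0) (h2 : cross2 P Q (x0, ym) ≤ 0) :
    ∃ z, z ∈ segment ℝ (x0, yn) P ∧ z ∈ segment ℝ (x0, ym) Q := by
  set g := (yn - ym) * (x0 - P.1) with hg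
  set h := (yn - ym) * (x0 - Q.1) with hh
  have gp : 0 < g := mul_pos (by linarith) (by linarith)
  have hp : 0 < h := mul_pos (by linarith) (by linarith)
  set D := g - cross2 P Q (x0, yn) with hD
  have hDp : 0 < D := by linarith
  have hD2 : D = h - cross2 P Q (x0, ym) := by
    rw [hD, hg, hh]; unfold cross2; ring
  refine ⟨(1 - h / D) • (x0, yn) + (h / D) • P, ⟨1 - h / D, h / D, ?_, by positivity, by ring, rfl⟩,
    ⟨1 - g / D, g / D, ?_, by positivity, by ring, ?_⟩⟩
  · rw [sub_nonneg, div_le_one hDp]; linarith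
  · rw [sub_nonneg, div_le_one hDp]; linarith
  · have hne := hDp.ne'
    ext
    · simp only [Prod.fst_add, Prod.smul_fst, smul_eq_mul]
      field_simp
      rw [hg, hh]; ring
    · simp only [Prod.snd_add, Prod.smul_snd, smul_eq_mul]
      field_simp
      rw [hD, hg, hh]; unfold cross2; ring

lemma segCrossR {P Q : Pt} {x0 yn ym : ℝ} (hP : x0 < P.1) (hQ : x0 < Q.1) (hy : yn < ym)
    (h1 : cross2 P Q (x0, yn) ≤ 0) (h2 : cross2 P Q (x0, ym) ≤ 0) :
    ∃ z, z ∈ segment ℝ (x0, yn) P ∧ z ∈ segment ℝ (x0, ym) Q := by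
  obtain ⟨z, ⟨a, b, ha, hb, hab, e1⟩, ⟨c, d, hc, hd, hcd, e2⟩⟩ :=
    segCrossL (P := -P) (Q := -Q) (x0 := -x0) (yn := -yn) (ym := -ym)
    (by simpa using hP) (by simpa using hQ) (by linarith)
    (by unfold cross2 at *; simp only [Prod.fst_neg, Prod.snd_neg]; linarith)
    (by unfold cross2 at *; simp only [Prod.fst_neg, Prod.snd_neg]; linarith)
  refine ⟨-z, ⟨a, b, ha, hb, hab, ?_⟩, ⟨c, d, hc, hd, hcd, ?_⟩⟩
  · rw [← e1]; ext <;> simp <;> ring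
  · rw [← e2]; ext <;> simp <;> ring

lemma crossX (A B : Pt) (x : ℝ) (h1 : A.1 < x) (h2 : x ≤ B.1) :
    ∃ z ∈ segment ℝ A B, z.1 = x := by
  obtain ⟨z, hz, h, -⟩ := segX A B x h1.le h2 (by linarith)
  exact ⟨z, hz, h⟩

lemma crossX' (A B : Pt) (x : ℝ) (h1 : x < A.1) (h2 : B.1 ≤ x) :
    ∃ z ∈ segment ℝ A B, z.1 = x := by
  obtain ⟨z, hz, h, -⟩ := segX B A x h2 h1.le (by linarith)
  exact ⟨z, segment_symm ℝ A B ▸ hz, h⟩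

def LCh (C : Set Pt) (T : Pt) : Prop := ∀ q ∈ C, q.2 = T.2 → T.1 ≤ q.1
def RCh (C : Set Pt) (T : Pt) : Prop := ∀ q ∈ C, q.2 = T.2 → q.1 ≤ T.1

structure Arc (C K : Set Pt) (c b : RL) (m1 n1 n2 m2 : Pt × Pt) : Prop where
  KC : K ⊆ C
  Kb : ∀ k ∈ K, ¬ b.In k
  Kc : ∀ k ∈ K, ¬ c.In k
  sm1 : m1.1 ∈ K
  sn1 : n1.1 ∈ K
  sm2 : m2.1 ∈ K
  sn2 : n2.1 ∈ K
  pm1 : m1.2 ∈ C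
  pn1 : n1.2 ∈ C
  pm2 : m2.2 ∈ C
  pn2 : n2.2 ∈ C
  rm1 : RCh C m1.2
  rn1 : RCh C n1.2
  ym1 : b.p.2 < m1.2.2 ∧ m1.2.2 < c.p.2
  yn1 : b.p.2 < n1.2.2 ∧ n1.2.2 < c.p.2
  zm2 : LCh C m2.2 ∨ ¬ (b.p.2 < m2.2.2 ∧ m2.2.2 < c.p.2)
  zn2 : LCh C n2.2 ∨ ¬ (b.p.2 < n2.2.2 ∧ n2.2.2 < c.p.2)
  ln1 : ∀ z ∈ segment ℝ n1.1 n1.2, ¬ b.In z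
  ln2 : ∀ z ∈ segment ℝ n2.1 n2.2, ¬ b.In z
  lm1 : ∀ z ∈ segment ℝ m1.1 m1.2, ¬ c.In z
  lm2 : ∀ z ∈ segment ℝ m2.1 m2.2, ¬ c.In z
  o1 : cross2 m1.2 n1.2 b.p ≤ 0
  o2 : cross2 m1.2 n1.2 c.p ≤ 0
  o3 : cross2 n2.2 m2.2 c.p ≤ 0
  o4 : cross2 n2.2 m2.2 b.p ≤ 0
  d1 : m1 = n1 ∨ ∀ z, z ∈ segment ℝ m1.1 m1.2 → z ∈ segment ℝ n1.1 n1.2 → False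
  d2 : m2 = n2 ∨ ∀ z, z ∈ segment ℝ m2.1 m2.2 → z ∈ segment ℝ n2.1 n2.2 → False
  deg : b.p.2 < n2.2.2 → n2.2.2 < c.p.2 → b.p.2 < m2.2.2 → m2.2.2 < c.p.2 → n2.2.2 ≤ m2.2.2
  ne1 : n2.2 ≠ c.p
  ne2 : m2.2 ≠ b.p

def flP (m : Pt × Pt) : Pt × Pt := (flY m.1, flY m.2)

lemma cross2_flY (a b c : Pt) : cross2 (flY a) (flY b) (flY c) = cross2 b a c := by
  unfold cross2 flY; ring

lemma RCh.fl {C : Set Pt} {T : Pt} (h : RCh C T) : RCh (fY C) (flY T) := by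
  intro q hq h2
  exact h (flY q) hq (by simp only [flY] at h2 ⊢; linarith)
lemma LCh.fl {C : Set Pt} {T : Pt} (h : LCh C T) : LCh (fY C) (flY T) := by
  intro q hq h2
  exact h (flY q) hq (by simp only [flY] at h2 ⊢; linarith)

lemma mem_fY {C : Set Pt} {q : Pt} (h : q ∈ C) : flY q ∈ fY C := by
  change flY (flY q) ∈ C; rwa [flY_flY]

lemma Arc.flip {C K : Set Pt} {c b : RL} {m1 n1 n2 m2 : Pt × Pt} (h : Arc C K c b m1 n1 n2 m2) :
    Arc (fY C) (fY K) b.flip c.flip (flP n1) (flP m1) (flP m2) (flP n2) := by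
  have ym1 := h.ym1
  have yn1 := h.yn1
  refine ⟨fun q hq => h.KC hq, fun k hk => ?_, fun k hk => ?_, mem_fY h.sn1, mem_fY h.sm1,
    mem_fY h.sn2, mem_fY h.sm2, mem_fY h.pn1, mem_fY h.pm1, mem_fY h.pn2, mem_fY h.pm2,
    h.rn1.fl, h.rm1.fl, ?_, ?_, ?_, ?_, ?_, ?_, ?_, ?_, ?_, ?_, ?_, ?_, ?_, ?_, ?_, ?_, ?_⟩
  · rw [RL.flip_In]; exact h.Kc _ hk
  · rw [RL.flip_In]; exact h.Kb _ hk
  · simp only [RL.flip, flP, flY]; constructor <;> linarith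
  · simp only [RL.flip, flP, flY]; constructor <;> linarith
  · rcases h.zn2 with h | h
    · exact Or.inl h.fl
    · right; intro h'; apply h; simp only [RL.flip, flP, flY] at h'; constructor <;> linarith
  · rcases h.zm2 with h | h
    · exact Or.inl h.fl
    · right; intro h'; apply h; simp only [RL.flip, flP, flY] at h'; constructor <;> linarith
  · intro z hz; rw [RL.flip_In]; exact h.lm1 _ (seg_flY hz)
  · intro z hz; rw [RL.flip_In]; exact h.lm2 _ (seg_flY hz)
  · intro z hz; rw [RL.flip_In]; exact h.ln1 _ (seg_flY hz)
  · intro z hz; rw [RL.flip_In]; exact h.ln2 _ (seg_flY hz)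
  · exact (cross2_flY n1.2 m1.2 c.p).trans_le h.o2
  · exact (cross2_flY n1.2 m1.2 b.p).trans_le h.o1
  · exact (cross2_flY m2.2 n2.2 b.p).trans_le h.o4
  · exact (cross2_flY m2.2 n2.2 c.p).trans_le h.o3
  · rcases h.d1 with h | h
    · exact Or.inl (by rw [h])
    · exact Or.inr fun z h1 h2 => h _ (seg_flY h2) (seg_flY h1)
  · rcases h.d2 with h | h
    · exact Or.inl (by rw [h])
    · exact Or.inr fun z h1 h2 => h _ (seg_flY h2) (seg_flY h1)
  · intro h1 h2 h3 h4
    simp only [RL.flip, flP, flY] at h1 h2 h3 h4 ⊢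
    linarith [h.deg (by linarith) (by linarith) (by linarith) (by linarith)]
  · intro he
    apply h.ne2
    have := congrArg flY he
    simp only [flP, flY_flY] at this
    rw [this]; simp [RL.flip, flY]
  · intro he
    apply h.ne1
    have := congrArg flY he
    simp only [flP, flY_flY] at this
    rw [this]; simp [RL.flip, flY]

lemma cross2_vert {P Q : Pt} {x0 y1 y2 y : ℝ} (h1 : cross2 P Q (x0, y1) ≤ 0)
    (h2 : cross2 P Q (x0, y2) ≤ 0) (hy1 : y1 ≤ y) (hy2 : y ≤ y2) : cross2 P Q (x0, y) ≤ 0 := by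
  unfold cross2 at *
  simp only at *
  rcases le_total 0 (Q.1 - P.1) with h | h
  · nlinarith [mul_le_mul_of_nonneg_left hy2 h]
  · nlinarith [mul_le_mul_of_nonpos_left hy1 h]

lemma lemX {C K : Set Pt} (hC : Convex ℝ C) (hK : Convex ℝ K) {c b : RL} (hc : c.Ok C)
    (hb : b.Ok C) {m1 n1 n2 m2 : Pt × Pt} (h : Arc C K c b m1 n1 n2 m2)
    (hx1 : c.p.1 ≤ b.p.1) (hx2 : b.p.1 ≤ c.w) (hl : c.l ≤ b.u)
    (hq : b.p.1 < n1.2.1) : False := by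
  have yn1 := h.yn1
  have ym1 := h.ym1
  have hbw := hb.le_w
  have hbl := hb.l_le
  have hcu := hc.le_u
  have hy : b.p.2 < c.p.2 := by linarith
  -- the vertical line
  have V : ∀ v ∈ C, v.1 = b.p.1 → b.p.2 ≤ v.2 ∧ v.2 ≤ c.p.2 := by
    intro v hv hv1
    constructor
    · by_contra hlt; push Not at hlt
      exact N1 hC hb.ch hv h.pn1 hv1.ge hq hlt yn1.1.le
    · by_contra hlt; push Not at hlt
      exact N2 hC hc.ch h.pn1 hv (by linarith) (by linarith) yn1.2.le hlt
  have Vb : ∀ v ∈ C, v.1 = b.p.1 → v.2 ≤ b.u → b.In v := fun v hv hv1 h2 =>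
    ⟨hv1.ge, by linarith, by linarith [(V v hv hv1).1], h2⟩
  have Vc : ∀ v ∈ C, v.1 = b.p.1 → c.l ≤ v.2 → c.In v := fun v hv hv1 h2 =>
    ⟨by linarith, by linarith, h2, by linarith [(V v hv hv1).2]⟩
  have Vk : ∀ k ∈ K, k.1 ≠ b.p.1 := by
    intro k hk he
    rcases le_total k.2 b.u with h' | h'
    · exact h.Kb k hk (Vb k (h.KC hk) he h')
    · exact h.Kc k hk (Vc k (h.KC hk) he (by linarith))
  have side : ∀ k ∈ K, ∀ k' ∈ K, k.1 < b.p.1 → k'.1 < b.p.1 := by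
    intro k hk k' hk' hlt
    by_contra hge; push Not at hge
    obtain ⟨z, hz, hz1⟩ := crossX k k' b.p.1 hlt hge
    exact Vk z (hK.segment_subset hk hk' hz) hz1
  have segC : ∀ m : Pt × Pt, m.1 ∈ K → m.2 ∈ C → ∀ z ∈ segment ℝ m.1 m.2, z ∈ C :=
    fun m h1 h2 z hz => hC.segment_subset (h.KC h1) h2 hz
  have zz : ∀ T ∈ C, (LCh C T ∨ ¬ (b.p.2 < T.2 ∧ T.2 < c.p.2)) → T.1 ≤ b.p.1 := by
    intro T hT hor
    by_contra hlt; push Not at hlt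
    have t1 : b.p.2 < T.2 := by
      by_contra hge; push Not at hge
      exact N2 hC hb.ch hT h.pn1 hlt hq.le hge yn1.1
    have t2 : T.2 < c.p.2 := by
      by_contra hge; push Not at hge
      exact N1 hC hc.ch hb.pC hT hx1 (by linarith) hy hge
    rcases hor with hor | hor
    · obtain ⟨z, hz, hz2, hz1⟩ := segY b.p c.p T.2 t1.le t2.le hy
      have := hor z (hC.segment_subset hb.pC hc.pC hz) hz2
      nlinarith [mul_nonneg (sub_nonneg.2 hx1) (sub_nonneg.2 t1.le),
        mul_pos (sub_pos.2 hlt) (sub_pos.2 hy), mul_nonneg (sub_nonneg.2 this) (sub_nonneg.2 hy.le)]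
    · exact hor ⟨t1, t2⟩
  have zn2 := zz _ h.pn2 h.zn2
  have zm2 := zz _ h.pm2 h.zm2
  by_cases hV : ∀ v ∈ C, v.1 = b.p.1 → v.2 ≤ b.u
  · rcases lt_or_gt_of_ne (Vk _ h.sn1) with hs | hs
    · obtain ⟨z, hz, hz1⟩ := crossX n1.1 n1.2 b.p.1 hs hq.le
      have zC := segC n1 h.sn1 h.pn1 z hz
      exact h.ln1 z hz (Vb z zC hz1 (hV z zC hz1))
    · have hs2 : b.p.1 < n2.1.1 := by
        by_contra hge; push Not at hge
        have := side _ h.sn2 _ h.sn1 (lt_of_le_of_ne hge (Vk _ h.sn2))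
        linarith
      obtain ⟨z, hz, hz1⟩ := crossX' n2.1 n2.2 b.p.1 hs2 zn2
      have zC := segC n2 h.sn2 h.pn2 z hz
      exact h.ln2 z hz (Vb z zC hz1 (hV z zC hz1))
  · push Not at hV
    obtain ⟨v, vC, v1, v2⟩ := hV
    have hcx : c.p.1 = b.p.1 := by
      refine le_antisymm hx1 ?_
      by_contra hlt; push Not at hlt
      have := Fpos hC hc (by linarith) vC (by linarith) (by linarith [(V v vC v1).2])
      linarith
    have eb : (b.p.1, b.p.2) = b.p := rfl
    have ec : (b.p.1, c.p.2) = c.p := by rw [← hcx]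
    have nb : ∀ z ∈ C, z.1 = b.p.1 → ¬ b.In z → b.u < z.2 := by
      intro z hz hz1 hn
      by_contra hge; push Not at hge
      exact hn (Vb z hz hz1 hge)
    have nc : ∀ z ∈ C, z.1 = b.p.1 → ¬ c.In z → z.2 < c.l := by
      intro z hz hz1 hn
      by_contra hge; push Not at hge
      exact hn (Vc z hz hz1 hge)
    rcases lt_or_gt_of_ne (Vk _ h.sn1) with hs | hs
    · have hm1 : b.p.1 < m1.2.1 := by
        by_contra hge; push Not at hge
        rcases le_total m1.2.2 n1.2.2 with h' | h'
        · exact N1 hC h.rm1 hb.pC h.pn1 hge (by linarith) ym1.1 h'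
        · exact N2 hC h.rm1 h.pn1 hc.pC (by linarith) (by linarith) h' ym1.2
      obtain ⟨z, hz, hz1⟩ := crossX n1.1 n1.2 b.p.1 hs hq.le
      obtain ⟨z', hz', hz1'⟩ := crossX m1.1 m1.2 b.p.1 (side _ h.sn1 _ h.sm1 hs) hm1.le
      have zC := segC n1 h.sn1 h.pn1 z hz
      have zC' := segC m1 h.sm1 h.pm1 z' hz'
      have y1 := nb z zC hz1 (h.ln1 z hz)
      have y2 := nc z' zC' hz1' (h.lm1 z' hz')
      rcases h.d1 with he | hd
      · rw [← he] at hz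
        have := nc z zC hz1 (h.lm1 z hz)
        linarith
      · have e1 : (b.p.1, z.2) = z := by rw [← hz1]
        have e2 : (b.p.1, z'.2) = z' := by rw [← hz1']
        obtain ⟨t, t1, t2⟩ := segCrossR (P := m1.2) (Q := n1.2) (x0 := b.p.1) (yn := z'.2)
          (ym := z.2) hm1 hq (by linarith)
          (cross2_vert (y1 := b.p.2) (y2 := c.p.2) h.o1 (by rw [ec]; exact h.o2) (V z' zC' hz1').1
            (V z' zC' hz1').2)
          (cross2_vert (y1 := b.p.2) (y2 := c.p.2) h.o1 (by rw [ec]; exact h.o2) (V z zC hz1).1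
            (V z zC hz1).2)
        rw [e2] at t1
        rw [e1] at t2
        exact hd t (seg_sub hz' t1) (seg_sub hz t2)
    · have hs' : ∀ k ∈ K, b.p.1 < k.1 := by
        intro k hk
        by_contra hge; push Not at hge
        have := side _ hk _ h.sn1 (lt_of_le_of_ne hge (Vk _ hk))
        linarith
      obtain ⟨z, hz, hz1⟩ := crossX' n2.1 n2.2 b.p.1 (hs' _ h.sn2) zn2
      obtain ⟨z', hz', hz1'⟩ := crossX' m2.1 m2.2 b.p.1 (hs' _ h.sm2) zm2
      have zC := segC n2 h.sn2 h.pn2 z hz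
      have zC' := segC m2 h.sm2 h.pm2 z' hz'
      have y1 := nb z zC hz1 (h.ln2 z hz)
      have y2 := nc z' zC' hz1' (h.lm2 z' hz')
      rcases h.d2 with he | hd
      · rw [← he] at hz
        have := nc z zC hz1 (h.lm2 z hz)
        linarith
      · have e1 : (b.p.1, z.2) = z := by rw [← hz1]
        have e2 : (b.p.1, z'.2) = z' := by rw [← hz1']
        have c1 := (cross2_vert (y1 := b.p.2) (y2 := c.p.2) h.o4 (by rw [ec]; exact h.o3)
          (V z zC hz1).1 (V z zC hz1).2)
        have c2 := (cross2_vert (y1 := b.p.2) (y2 := c.p.2) h.o4 (by rw [ec]; exact h.o3)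
          (V z' zC' hz1').1 (V z' zC' hz1').2)
        have hport : ∀ T : Pt, T.1 = b.p.1 → ∀ s : Pt, b.p.1 < s.1 → ∀ z ∈ segment ℝ s T,
            z.1 = b.p.1 → z = T := by
          rintro T hT s hs z ⟨α, β, hα, hβ, hαβ, rfl⟩ h1
          simp only [Prod.fst_add, Prod.smul_fst, smul_eq_mul] at h1
          have : α * (s.1 - b.p.1) = 0 := by
            rw [hT] at h1
            have : β = 1 - α := by linarith
            rw [this] at h1
            linarith
          have : α = 0 := by
            rcases mul_eq_zero.1 this with h | h
            · exact h
            · linarith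
          have h1 : β = 1 := by linarith
          rw [this, h1]; simp
        rcases zn2.lt_or_eq with a1 | a1 <;> rcases zm2.lt_or_eq with a2 | a2
        · obtain ⟨t, t1, t2⟩ := segCrossL (P := n2.2) (Q := m2.2) (x0 := b.p.1) (yn := z.2)
            (ym := z'.2) a1 a2 (by linarith) c1 c2
          rw [e1] at t1
          rw [e2] at t2
          exact hd t (seg_sub hz' t2) (seg_sub hz t1)
        · have := hport _ a2 _ (hs' _ h.sm2) z' hz' hz1'
          rw [← this] at c1
          unfold cross2 at c1
          simp only [hz1'] at c1
          nlinarith [mul_pos (sub_pos.2 a1) (sub_pos.2 (lt_of_lt_of_le y2 (hl.trans y1.le)))]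
        · have := hport _ a1 _ (hs' _ h.sn2) z hz hz1
          rw [← this] at c2
          unfold cross2 at c2
          simp only [hz1] at c2
          nlinarith [mul_pos (sub_pos.2 a2) (sub_pos.2 (lt_of_lt_of_le y2 (hl.trans y1.le)))]
        · have f1 := hport _ a1 _ (hs' _ h.sn2) z hz hz1
          have f2 := hport _ a2 _ (hs' _ h.sm2) z' hz' hz1'
          have v1 := V z zC hz1
          have v2 := V z' zC' hz1'
          have n1 : z.2 ≠ c.p.2 := fun he => h.ne1 (by rw [← f1, ← ec, ← he, e1])
          have n2 : z'.2 ≠ b.p.2 := fun he => h.ne2 (by rw [← f2, ← eb, ← he, e2])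
          have k1 := lt_of_le_of_ne v1.2 n1
          have k2 := lt_of_le_of_ne v2.1 n2.symm
          have := h.deg (by rw [← f1]; linarith) (by rw [← f1]; linarith) (by rw [← f2]; linarith)
            (by rw [← f2]; linarith)
          rw [← f1, ← f2] at this
          linarith

lemma lemX' {C K : Set Pt} (hC : Convex ℝ C) (hK : Convex ℝ K) {c b : RL} (hc : c.Ok C)
    (hb : b.Ok C) {m1 n1 n2 m2 : Pt × Pt} (h : Arc C K c b m1 n1 n2 m2)
    (hx1 : b.p.1 ≤ c.p.1) (hx2 : c.p.1 ≤ b.w) (hl : c.l ≤ b.u)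
    (hq : c.p.1 < m1.2.1) : False :=
  lemX (fY_convex hC) (fY_convex hK) hb.flip hc.flip h.flip hx1 hx2
    (by simp only [RL.flip]; linarith) hq

def RL.sp (a : RL) : Pt × Pt := (a.s, a.p)

section T
variable {ι : Type} (I : Finset ι) (r : ι → RL) (adj : ι → ι → Prop)

def Rem (i : ι) (z : Pt) : Prop :=
  (r i).w = (r i).p.1 ∧
  (((r i).top = false ∧ (r i).p.2 < z.2 ∧
      ∃ m ∈ I, adj m i ∧ (r i).p.2 < (r m).p.2 ∧ (r i).p.1 < (r m).p.1) ∨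
   ((r i).top = true ∧ z.2 < (r i).p.2 ∧
      ∃ m ∈ I, adj m i ∧ (r m).p.2 < (r i).p.2 ∧ (r i).p.1 < (r m).p.1))

def PP (a b : ι) : Prop :=
  (∀ z, (r b).In z → ¬ Rem I r adj b z → (r a).D z) ∧ (∀ z, (r b).D z → (r a).D z) ∧
  (∀ z, (r a).In z → ¬ Rem I r adj a z → (r b).U z) ∧ (∀ z, (r a).U z → (r b).U z)

lemma PP_adj {C : Set Pt} (hC : Convex ℝ C) (ok : ∀ i ∈ I, (r i).Ok C)
    (hp : ∀ i ∈ I, ∀ j ∈ I, i ≠ j → adj i j → HP (r i) (r j)) (symm : ∀ i j, adj i j → adj j i)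
    {a b : ι} (ha : a ∈ I) (hb : b ∈ I) (h : adj a b) (hy : (r b).p.2 < (r a).p.2) :
    PP I r adj a b := by
  have hne : a ≠ b := by rintro rfl; exact lt_irrefl _ hy
  have hab := hp a ha b hb hne h
  have hba := hp b hb a ha hne.symm (symm _ _ h)
  have oa := ok a ha
  have ob := ok b hb
  have hyf : (r a).flip.p.2 < (r b).flip.p.2 := by simpa [RL.flip] using hy
  refine ⟨?_, ?_, ?_, ?_⟩
  · intro z hz hr
    refine claim1 hC oa ob hab hba hy hz fun h1 h2 h3 => ?_
    by_contra hc; push Not at hc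
    exact hr ⟨h1, Or.inl ⟨h2, hc, a, ha, h, hy, h3⟩⟩
  · intro z hz
    refine claim2 oa ob hab hy (fun z hz hor => ?_) hz
    refine claim1 hC oa ob hab hba hy hz fun h1 h2 h3 => ?_
    rcases hor with h | h
    · rw [h]; unfold RL.h; simp [h2, ob.l_le]
    · rw [h]
  · intro z hz hr
    have := (RL.flip_D (r b) (flY z)).1 (claim1 (fY_convex hC) ob.flip oa.flip hba.flip hab.flip
      hyf (z := flY z) (by rw [RL.flip_In, flY_flY]; exact hz) fun h1 h2 h3 => ?_)
    · rwa [flY_flY] at this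
    · by_contra hc; push Not at hc
      simp only [RL.flip, flY] at h1 h2 h3 hc
      exact hr ⟨h1, Or.inr ⟨by simpa using h2, by linarith, b, hb, symm _ _ h, hy, h3⟩⟩
  · intro z hz
    have := (RL.flip_D (r b) (flY z)).1 (claim2 ob.flip oa.flip hba.flip
      hyf (z := flY z) (fun z hz hor => ?_) (by rw [RL.flip_D, flY_flY]; exact hz))
    · rwa [flY_flY] at this
    · refine claim1 (fY_convex hC) ob.flip oa.flip hba.flip hab.flip hyf hz fun h1 h2 h3 => ?_
      rcases hor with h | h
      · rw [h]; unfold RL.h; simp [h2, oa.flip.l_le]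
      · rw [h]

lemma PP_all {C : Set Pt} (hC : Convex ℝ C) (ok : ∀ i ∈ I, (r i).Ok C)
    (hp : ∀ i ∈ I, ∀ j ∈ I, i ≠ j → adj i j → HP (r i) (r j)) (symm : ∀ i j, adj i j → adj j i)
    (hbt : ∀ c ∈ I, ∀ b ∈ I, (r b).p.2 < (r c).p.2 → ¬ adj c b →
      ∃ m ∈ I, (r b).p.2 < (r m).p.2 ∧ (r m).p.2 < (r c).p.2) (n : ℕ) :
    ∀ a ∈ I, ∀ b ∈ I, (r b).p.2 < (r a).p.2 →
      (I.filter fun m => (r b).p.2 < (r m).p.2 ∧ (r m).p.2 < (r a).p.2).card = n →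
      PP I r adj a b := by
  induction n using Nat.strong_induction_on with
  | _ n ih =>
    intro a ha b hb hy hn
    by_cases hadj : adj a b
    · exact PP_adj I r adj hC ok hp symm ha hb hadj hy
    · obtain ⟨m, hm, m1, m2⟩ := hbt a ha b hb hy hadj
      have A : PP I r adj a m := by
        refine ih _ ?_ a ha m hm m2 rfl
        rw [← hn]
        apply Finset.card_lt_card
        rw [Finset.ssubset_iff_of_subset]
        · exact ⟨m, by simp [hm, m1, m2], by simp⟩
        · intro k; simp only [Finset.mem_filter]
          rintro ⟨h, h1, h2⟩; exact ⟨h, by linarith, h2⟩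
      have B : PP I r adj m b := by
        refine ih _ ?_ m hm b hb m1 rfl
        rw [← hn]
        apply Finset.card_lt_card
        rw [Finset.ssubset_iff_of_subset]
        · exact ⟨m, by simp [hm, m1, m2], by simp⟩
        · intro k; simp only [Finset.mem_filter]
          rintro ⟨h, h1, h2⟩; exact ⟨h, h1, by linarith⟩
      exact ⟨fun z h1 h2 => A.2.1 z (B.1 z h1 h2), fun z h1 => A.2.1 z (B.2.1 z h1),
        fun z h1 h2 => B.2.2.2 z (A.2.2.1 z h1 h2), fun z h1 => B.2.2.2 z (A.2.2.2 z h1)⟩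

theorem absT {C K : Set Pt} (hC : Convex ℝ C) (hK : Convex ℝ K) (ok : ∀ i ∈ I, (r i).Ok C)
    (hp : ∀ i ∈ I, ∀ j ∈ I, i ≠ j → adj i j → HP (r i) (r j)) (symm : ∀ i j, adj i j → adj j i)
    (harc : ∀ c ∈ I, ∀ b ∈ I, (r b).p.2 < (r c).p.2 → ¬ adj c b →
      ∃ m1 ∈ I, ∃ n1 ∈ I, ∃ n2 m2, Arc C K (r c) (r b) (r m1).sp (r n1).sp n2 m2 ∧
      (∀ m ∈ I, adj m b → (r b).p.2 < (r m).p.2 → (r m).p.2 < (r c).p.2 → m = n1) ∧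
      (∀ m ∈ I, adj m c → (r b).p.2 < (r m).p.2 → (r m).p.2 < (r c).p.2 → m = m1))
    (c : ι) (hc : c ∈ I) (b : ι) (hb : b ∈ I) (hy : (r b).p.2 < (r c).p.2) (hadj : ¬ adj c b)
    (z : Pt) (zc : (r c).In z) (zb : (r b).In z) : False := by
  obtain ⟨m1, hm1, n1, hn1, n2, m2, arc, un, um⟩ := harc c hc b hb hy hadj
  have oc := ok c hc
  have ob := ok b hb
  have hbt : ∀ c ∈ I, ∀ b ∈ I, (r b).p.2 < (r c).p.2 → ¬ adj c b →
      ∃ m ∈ I, (r b).p.2 < (r m).p.2 ∧ (r m).p.2 < (r c).p.2 := by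
    intro c hc b hb hy hadj
    obtain ⟨m1, hm1, n1, hn1, n2, m2, arc, un, um⟩ := harc c hc b hb hy hadj
    exact ⟨m1, hm1, arc.ym1⟩
  have good : ∀ z, (r c).In z → (r b).In z → ¬ Rem I r adj c z → ¬ Rem I r adj b z → False := by
    intro z zc zb nc nb
    have A := PP_all I r adj hC ok hp symm hbt _ c hc m1 hm1 arc.ym1.2 rfl
    have B := PP_all I r adj hC ok hp symm hbt _ m1 hm1 b hb arc.ym1.1 rfl
    exact (r m1).DU z (B.1 z zb nb) (A.2.2.1 z zc nc)
  have X : ∀ z, (r c).In z → (r b).In z → (r b).w = (r b).p.1 →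
      (∃ m ∈ I, adj m b ∧ (r b).p.2 < (r m).p.2 ∧ (r b).p.1 < (r m).p.1) → False := by
    rintro z ⟨c1, c2, c3, c4⟩ ⟨b1, b2, b3, b4⟩ hw ⟨m, hm, ma, my, mx⟩
    have hlt : (r m).p.2 < (r c).p.2 := by
      by_contra hge; push Not at hge
      exact N1 hC oc.ch ob.pC (ok m hm).pC (by linarith) (by linarith) hy hge
    have := un m hm ma my hlt
    subst this
    exact lemX hC hK oc ob arc (by linarith) (by linarith) (by linarith) mx
  have X' : ∀ z, (r c).In z → (r b).In z → (r c).w = (r c).p.1 →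
      (∃ m ∈ I, adj m c ∧ (r m).p.2 < (r c).p.2 ∧ (r c).p.1 < (r m).p.1) → False := by
    rintro z ⟨c1, c2, c3, c4⟩ ⟨b1, b2, b3, b4⟩ hw ⟨m, hm, ma, my, mx⟩
    have hlt : (r b).p.2 < (r m).p.2 := by
      by_contra hge; push Not at hge
      exact N2 hC ob.ch (ok m hm).pC oc.pC (by linarith) (by linarith) hge hy
    have := um m hm ma hlt my
    subst this
    exact lemX' hC hK oc ob arc (by linarith) (by linarith) (by linarith) mx
  have hbl := ob.l_le
  have hbu := ob.le_u
  have hbw := ob.le_w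
  have hcl := oc.l_le
  have hcu := oc.le_u
  have hcw := oc.le_w
  have pb : (r b).In (r b).p := ⟨le_rfl, hbw, hbl, hbu⟩
  have pc : (r c).In (r c).p := ⟨le_rfl, hcw, hcl, hcu⟩
  have rc : ¬ Rem I r adj c (r c).p := by
    rintro ⟨-, ⟨-, h, -⟩ | ⟨-, h, -⟩⟩ <;> exact lt_irrefl _ h
  have rb : ¬ Rem I r adj b (r b).p := by
    rintro ⟨-, ⟨-, h, -⟩ | ⟨-, h, -⟩⟩ <;> exact lt_irrefl _ h
  have Y : (r c).In (r b).p → False := by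
    intro h
    by_cases hr : Rem I r adj c (r b).p
    · rcases hr with ⟨hw, ⟨-, h', -⟩ | ⟨-, -, h'⟩⟩
      · linarith
      · exact X' _ h pb hw h'
    · exact good _ h pb hr rb
  have Y' : (r b).In (r c).p → False := by
    intro h
    by_cases hr : Rem I r adj b (r c).p
    · rcases hr with ⟨hw, ⟨-, -, h'⟩ | ⟨-, h', -⟩⟩
      · exact X _ pc h hw h'
      · linarith
    · exact good _ pc h rc hr
  have zc' := zc
  have zb' := zb
  obtain ⟨c1, c2, c3, c4⟩ := zc'
  obtain ⟨b1, b2, b3, b4⟩ := zb'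
  by_cases hrb : Rem I r adj b z
  · rcases hrb with ⟨hw, ⟨-, -, h'⟩ | ⟨-, h', -⟩⟩
    · exact X z zc zb hw h'
    · exact Y ⟨by linarith, by linarith, by linarith, by linarith⟩
  by_cases hrc : Rem I r adj c z
  · rcases hrc with ⟨hw, ⟨-, h', -⟩ | ⟨-, -, h'⟩⟩
    · exact Y' ⟨by linarith, by linarith, by linarith, by linarith⟩
    · exact X' z zc zb hw h'
  exact good z zc zb hrc hrb
end T

lemma EhR {C : Set Pt} (hC : Convex ℝ C) {A B X : Pt} (hA : A ∈ C) (hB : B ∈ C)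
    (ch : ∀ q ∈ C, q.2 = X.2 → q.1 ≤ X.1) (h1 : A.2 ≤ X.2) (h2 : X.2 ≤ B.2) (h : A.2 < B.2) :
    A.1 * (B.2 - X.2) + B.1 * (X.2 - A.2) ≤ X.1 * (B.2 - A.2) := by
  obtain ⟨z, hz, z2, z1⟩ := segY A B X.2 h1 h2 h
  have := ch z (hC.segment_subset hA hB hz) z2
  rw [← z1]
  exact mul_le_mul_of_nonneg_right this (by linarith)

lemma EhL {C : Set Pt} (hC : Convex ℝ C) {A B X : Pt} (hA : A ∈ C) (hB : B ∈ C)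
    (ch : ∀ q ∈ C, q.2 = X.2 → X.1 ≤ q.1) (h1 : A.2 ≤ X.2) (h2 : X.2 ≤ B.2) (h : A.2 < B.2) :
    X.1 * (B.2 - A.2) ≤ A.1 * (B.2 - X.2) + B.1 * (X.2 - A.2) := by
  obtain ⟨z, hz, z2, z1⟩ := segY A B X.2 h1 h2 h
  have := ch z (hC.segment_subset hA hB hz) z2
  rw [← z1]
  exact mul_le_mul_of_nonneg_right this (by linarith)

lemma Wlem {C : Set Pt} (hC : IsContour C) {T A B : Pt} (hL : T ∈ leftChain C)
    (hR : T ∈ rightChain C) (hA : A ∈ C) (hB : B ∈ C) (h1 : A.2 < T.2) (h2 : T.2 < B.2) :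
    False := by
  obtain ⟨o, ho⟩ := hC.nonempty_interior
  obtain ⟨e, he, hsub⟩ := Metric.isOpen_iff.1 isOpen_interior o ho
  have ho' : ((o.1 + e / 2, o.2) : Pt) ∈ C := by
    apply interior_subset
    apply hsub
    rw [Metric.mem_ball, Prod.dist_eq]
    simp [Real.dist_eq, abs_of_pos he]
    exact he
  have hoC := interior_subset ho
  obtain ⟨-, -, l⟩ := hL
  obtain ⟨-, -, r⟩ := hR
  rcases le_or_gt o.2 T.2 with h | h
  · have a1 := EhR hC.convex hoC hB r h h2.le (by linarith)
    have a2 := EhL hC.convex hoC hB l h h2.le (by linarith)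
    have a3 := EhR hC.convex ho' hB r h h2.le (by simp only; linarith)
    simp only at a3
    nlinarith [mul_pos he (sub_pos.2 h2)]
  · have a1 := EhR hC.convex hA hoC r h1.le h.le (by linarith)
    have a2 := EhL hC.convex hA hoC l h1.le h.le (by linarith)
    have a3 := EhR hC.convex hA ho' r h1.le h.le (by simp only; linarith)
    simp only at a3
    nlinarith [mul_pos he (sub_pos.2 h1)]

lemma cwR {C : Set Pt} {p q : Pt} (h : CwLT C p q) (hq : q ∈ rightChain C) :
    p ∈ rightChain C ∧ q.2 < p.2 := by
  rcases h with h | h | h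
  · exact ⟨h.1, h.2.2⟩
  · exact absurd hq h.2.2
  · exact absurd hq h.2.2.2.1

lemma cwL {C : Set Pt} {p q : Pt} (h : CwLT C p q) (hp : p ∉ rightChain C) :
    p ∈ leftChain C ∧ q ∈ leftChain C ∧ q ∉ rightChain C ∧ p.2 < q.2 := by
  rcases h with h | h | h
  · exact absurd h.1 hp
  · exact absurd h.1 hp
  · exact h.2

lemma cw_irrefl {C : Set Pt} {p : Pt} (h : CwLT C p p) : False := by
  by_cases hp : p ∈ rightChain C
  · exact lt_irrefl _ (cwR h hp).2
  · exact lt_irrefl _ (cwL h hp).2.2.2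

lemma cw_trans {C : Set Pt} {p q r : Pt} (h : CwLT C p q) (h' : CwLT C q r) : CwLT C p r := by
  by_cases hq : q ∈ rightChain C
  · obtain ⟨hp, hpq⟩ := cwR h hq
    rcases h' with h' | h' | h'
    · exact Or.inl ⟨hp, h'.2.1, h'.2.2.trans hpq⟩
    · exact Or.inr (Or.inl ⟨hp, h'.2⟩)
    · exact absurd hq h'.1
  · obtain ⟨-, rL, rR, hqr⟩ := cwL h' hq
    rcases h with h | h | h
    · exact absurd h.2.1 hq
    · exact Or.inr (Or.inl ⟨h.1, rL, rR⟩)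
    · exact Or.inr (Or.inr ⟨h.1, h.2.1, rL, rR, h.2.2.2.2.trans hqr⟩)

lemma cw_tri {C : Set Pt} (hC : Convex ℝ C) {p q r : Pt} (h : CwLT C p q) (h' : CwLT C q r) :
    cross2 p q r ≤ 0 := by
  unfold cross2
  by_cases hq : q ∈ rightChain C
  · obtain ⟨hp, hpq⟩ := cwR h hq
    by_cases hr : r ∈ rightChain C
    · have hqr := (cwR h' hr).2
      have := EhR hC hr.1 hp.1 hq.2.2 hqr.le hpq.le (by linarith)
      linarith
    · have hrL : r ∈ leftChain C := by
        rcases h' with h' | h' | h'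
        · exact absurd h'.2.1 hr
        · exact h'.2.1
        · exact absurd hq h'.1
      rcases lt_or_ge r.2 q.2 with h1 | h1
      · have := EhR hC hrL.1 hp.1 hq.2.2 h1.le hpq.le (by linarith)
        linarith
      rcases le_or_gt r.2 p.2 with h2 | h2
      · have := EhL hC hq.1 hp.1 hrL.2.2 h1 h2 hpq
        linarith
      · have := EhR hC hq.1 hrL.1 hp.2.2 hpq.le h2.le (by linarith)
        linarith
  · obtain ⟨hqL, rL, rR, hqr⟩ := cwL h' hq
    by_cases hp : p ∈ rightChain C
    · rcases lt_or_ge p.2 q.2 with h1 | h1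
      · have := EhL hC hp.1 rL.1 hqL.2.2 h1.le hqr.le (by linarith)
        linarith
      rcases le_or_gt p.2 r.2 with h2 | h2
      · have := EhR hC hqL.1 rL.1 hp.2.2 h1 h2 hqr
        linarith
      · have := EhL hC hqL.1 hp.1 rL.2.2 hqr.le h2.le (by linarith)
        linarith
    · obtain ⟨hpL, -, -, hpq⟩ := cwL h hp
      have := EhL hC hpL.1 rL.1 hqL.2.2 hpq.le hqr.le (by linarith)
      linarith

lemma left_eq {C : Set Pt} {p q : Pt} (hp : p ∈ leftChain C) (hq : q ∈ leftChain C)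
    (h : p.2 = q.2) : p = q :=
  Prod.ext (le_antisymm (hp.2.2 q hq.1 h.symm) (hq.2.2 p hp.1 h)) h

/-- list tools -/
def Nx (L : List Label) (a b : Label) : Prop := (a, b) ∈ L.zip (L.rotate 1)

lemma nx_rotate {L : List Label} {a b : Label} (k : ℕ) : Nx (L.rotate k) a b ↔ Nx L a b := by
  unfold Nx
  rw [List.rotate_rotate, Nat.add_comm, ← List.rotate_rotate, List.zip,
    ← List.zipWith_rotate_distrib _ _ _ _ (by simp), List.mem_rotate]

lemma nx_of_rot {L B : List Label} {a b : Label} (h : L ~r (a :: b :: B)) : Nx L a b := by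
  obtain ⟨k, hk⟩ := h
  rw [← nx_rotate k, hk]
  simp [Nx]

lemma nx_right {L : List Label} (hn : L.Nodup) {a b b' : Label} (h : Nx L a b) (h' : Nx L a b') :
    b = b' := by
  obtain ⟨i, hi, e⟩ := List.mem_iff_getElem.1 h
  obtain ⟨j, hj, e'⟩ := List.mem_iff_getElem.1 h'
  rw [List.getElem_zip, Prod.mk.injEq] at e e'
  have : i = j := (hn.getElem_inj_iff).1 (e.1.trans e'.1.symm)
  subst this
  rw [← e.2, ← e'.2]

lemma nx_left {L : List Label} (hn : L.Nodup) {a a' b : Label} (h : Nx L a b) (h' : Nx L a' b) :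
    a = a' := by
  obtain ⟨i, hi, e⟩ := List.mem_iff_getElem.1 h
  obtain ⟨j, hj, e'⟩ := List.mem_iff_getElem.1 h'
  rw [List.getElem_zip, Prod.mk.injEq] at e e'
  have : i = j := ((List.nodup_rotate.2 hn).getElem_inj_iff).1 (e.2.trans e'.2.symm)
  subst this
  rw [← e.1, ← e'.1]

def TriL (l : List Label) : Prop :=
  ∀ x y z : Label, [x, y, z].Sublist l → cross2 x.port y.port z.port ≤ 0

lemma cross2_cyc (a b c : Pt) : cross2 a b c = cross2 c a b := by
  unfold cross2; ring

lemma TriL.rot1 {l : List Label} (h : TriL l) : TriL (l.rotate 1) := by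
  cases l with
  | nil => simpa using h
  | cons x l =>
    rw [List.rotate_cons_succ, List.rotate_zero]
    intro a b c hs
    have hs' := hs.reverse
    simp only [List.reverse_append, List.reverse_cons, List.reverse_nil, List.nil_append,
      List.cons_append] at hs'
    rw [List.sublist_cons_iff] at hs'
    rcases hs' with hs' | ⟨r, hr, hs'⟩
    · apply h
      have := hs'.reverse
      simp at this
      exact this.cons _
    · simp only [List.cons.injEq] at hr
      obtain ⟨rfl, rfl⟩ := hr
      rw [cross2_cyc]
      apply h
      have := hs'.reverse
      simp at this
      exact this.cons_cons _

lemma TriL.rot {l l' : List Label} (h : TriL l) (hr : l ~r l') : TriL l' := by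
  obtain ⟨k, rfl⟩ := hr
  induction k with
  | zero => simpa using h
  | succ k ih => rw [← List.rotate_rotate]; exact ih.rot1

lemma cross2_self (p q : Pt) : cross2 p p q = 0 := by unfold cross2; ring

lemma first_last {l : List Label} (hl : l ≠ []) : ∃ P Q, (∃ t, l = P :: t) ∧ (∃ t, l = t ++ [Q]) ∧
    (P = Q ∨ [P, Q].Sublist l) := by
  cases l with
  | nil => exact absurd rfl hl
  | cons P t =>
    rcases List.eq_nil_or_concat t with rfl | ⟨t', Q, rfl⟩
    · exact ⟨P, P, ⟨[], rfl⟩, ⟨[], rfl⟩, Or.inl rfl⟩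
    · refine ⟨P, Q, ⟨_, rfl⟩, ⟨P :: t', by simp⟩, Or.inr ?_⟩
      simp

lemma arcG {L l1 l2 : List Label} {u v : Label} (hn : L.Nodup) (ht : TriL L)
    (hr : L ~r (u :: (l1 ++ v :: l2))) (hc : ¬ Consecutive L u v) :
    ∃ P1 ∈ l1, ∃ Q1 ∈ l1, ∃ P2 ∈ l2, ∃ Q2 ∈ l2,
      Nx L u P1 ∧ Nx L Q1 v ∧ Nx L v P2 ∧ Nx L Q2 u ∧
      cross2 P1.port Q1.port u.port ≤ 0 ∧ cross2 P1.port Q1.port v.port ≤ 0 ∧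
      cross2 P2.port Q2.port u.port ≤ 0 ∧ cross2 P2.port Q2.port v.port ≤ 0 ∧
      (∀ R : Label → Label → Prop, l2.Pairwise R → P2 = Q2 ∨ R P2 Q2) ∧
      (∀ m ∈ l1, Consecutive L m u → m = P1) ∧ (∀ m ∈ l1, Consecutive L m v → m = Q1) := by
  have h1 : l1 ≠ [] := by
    rintro rfl
    exact hc (Or.inl (nx_of_rot hr))
  have rv : L ~r (v :: (l2 ++ u :: l1)) := by
    refine hr.trans ?_
    have := @List.isRotated_append _ (u :: l1) (v :: l2)
    simpa using this
  have h2 : l2 ≠ [] := by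
    rintro rfl
    exact hc (Or.inr (nx_of_rot rv))
  obtain ⟨P1, Q1, ⟨t1, e1⟩, ⟨s1, f1⟩, g1⟩ := first_last h1
  obtain ⟨P2, Q2, ⟨t2, e2⟩, ⟨s2, f2⟩, g2⟩ := first_last h2
  have n1 : Nx L u P1 := by rw [e1] at hr; exact nx_of_rot hr
  have n2 : Nx L v P2 := by rw [e2] at rv; exact nx_of_rot rv
  have n3 : Nx L Q1 v := by
    refine nx_of_rot (B := l2 ++ u :: s1) (hr.trans ?_)
    have := @List.isRotated_append _ (u :: s1) (Q1 :: v :: l2)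
    rw [f1]
    simpa using this
  have n4 : Nx L Q2 u := by
    refine nx_of_rot (B := l1 ++ v :: s2) (rv.trans ?_)
    have := @List.isRotated_append _ (v :: s2) (Q2 :: u :: l1)
    rw [f2]
    simpa using this
  have mP1 : P1 ∈ l1 := by rw [e1]; simp
  have mP2 : P2 ∈ l2 := by rw [e2]; simp
  have mQ1 : Q1 ∈ l1 := by rw [f1]; simp
  have mQ2 : Q2 ∈ l2 := by rw [f2]; simp
  have tu := ht.rot hr
  have tv := ht.rot rv
  have nd : (u :: (l1 ++ v :: l2)).Nodup := hr.nodup_iff.1 hn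
  have dis : ∀ m ∈ l1, m ∉ l2 := by
    intro m h h'
    have := (List.nodup_cons.1 nd).2
    rw [List.nodup_append] at this
    exact this.2.2 m h m (by simp [h']) rfl
  refine ⟨P1, mP1, Q1, mQ1, P2, mP2, Q2, mQ2, n1, n3, n2, n4, ?_, ?_, ?_, ?_, ?_, ?_, ?_⟩
  · rcases g1 with rfl | g
    · rw [cross2_self]
    · rw [cross2_cyc]
      exact tu _ _ _ ((g.trans (List.sublist_append_left _ _)).cons_cons _)
  · rcases g1 with rfl | g
    · rw [cross2_self]
    · apply tu
      refine List.Sublist.cons _ ?_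
      exact List.Sublist.append (l₁ := [P1, Q1]) (r₁ := [v]) g (by simp)
  · rcases g2 with rfl | g
    · rw [cross2_self]
    · apply tv
      refine List.Sublist.cons _ ?_
      exact List.Sublist.append (l₁ := [P2, Q2]) (r₁ := [u]) g (by simp)
  · rcases g2 with rfl | g
    · rw [cross2_self]
    · rw [cross2_cyc]
      exact tv _ _ _ ((g.trans (List.sublist_append_left _ _)).cons_cons _)
  · intro R hR
    rcases g2 with h | g
    · exact Or.inl h
    · have := hR.sublist g
      simp at this
      exact Or.inr this
  · rintro m hm (h | h)
    · have := nx_left hn h n4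
      subst this
      exact absurd mQ2 (dis _ hm)
    · exact nx_right hn h n1
  · rintro m hm (h | h)
    · exact nx_left hn h n3
    · have := nx_right hn h n2
      subst this
      exact absurd mP2 (dis _ hm)

lemma two_split {L : List Label} {x y : Label} (hx : x ∈ L) (hy : y ∈ L) (hne : x ≠ y) :
    (∃ l0 l1 l3, L = l0 ++ x :: (l1 ++ y :: l3)) ∨ (∃ l0 l1 l3, L = l0 ++ y :: (l1 ++ x :: l3)) := by
  obtain ⟨s, t, rfl⟩ := List.append_of_mem hx
  rcases List.mem_append.1 hy with h | h
  · obtain ⟨s', t', rfl⟩ := List.append_of_mem h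
    exact Or.inr ⟨s', t', t, by simp⟩
  · rcases List.mem_cons.1 h with h | h
    · exact absurd h.symm hne
    · obtain ⟨s', t', rfl⟩ := List.append_of_mem h
      exact Or.inl ⟨s, s', t', by simp⟩

def BtwL (b c m : Label) : Prop := b.port.2 < m.port.2 ∧ m.port.2 < c.port.2

lemma pw_split {R : Label → Label → Prop} {l0 l1 l3 : List Label} {x y : Label}
    (h : (l0 ++ x :: (l1 ++ y :: l3)).Pairwise R) :
    R x y ∧ (∀ m ∈ l0, R m x ∧ R m y) ∧ (∀ m ∈ l1, R x m ∧ R m y) ∧ (∀ m ∈ l3, R x m ∧ R y m) ∧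
    l0.Pairwise R ∧ l1.Pairwise R ∧ l3.Pairwise R := by
  rw [List.pairwise_append, List.pairwise_cons, List.pairwise_append, List.pairwise_cons] at h
  obtain ⟨h0, ⟨hx, h1, ⟨hy, h3⟩, h13⟩, h01⟩ := h
  refine ⟨hx y (by simp), fun m hm => ⟨h01 m hm x (by simp), h01 m hm y (by simp)⟩,
    fun m hm => ⟨hx m (by simp [hm]), h13 m hm y (by simp)⟩,
    fun m hm => ⟨hx m (by simp [hm]), hy m hm⟩, h0, h1, h3⟩

lemma decR {C : Set Pt} (hC : IsContour C) {L : List Label}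
    (hpw : L.Pairwise (fun a b => CwLT C a.port b.port)) (hch : PortsOnChains C L)
    {b c : Label} (hb : b ∈ L) (hc : c ∈ L) (lb : b.isLeft = false) (lc : c.isLeft = false)
    (hy : b.port.2 < c.port.2) :
    ∃ l1 l2, L ~r (c :: (l1 ++ b :: l2)) ∧ (∀ m ∈ l1, m.isLeft = false ∧ BtwL b c m) ∧
      (∀ m ∈ l2, ¬ (m.isLeft = false ∧ BtwL b c m)) ∧
      l2.Pairwise (fun m n => BtwL b c m → BtwL b c n → m.port.2 ≤ n.port.2) := by
  have bR := (hch b hb).2 lb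
  have cR := (hch c hc).2 lc
  have hne : c ≠ b := by rintro rfl; exact lt_irrefl _ hy
  rcases two_split hc hb hne with ⟨l0, l1, l3, rfl⟩ | ⟨l0, l1, l3, rfl⟩
  swap
  · obtain ⟨h, -⟩ := pw_split hpw
    have := (cwR h cR).2
    linarith
  obtain ⟨hcb, h0, h1, h3, p0, p1, p3⟩ := pw_split hpw
  have N0 : ∀ m ∈ l0, ¬ BtwL b c m := by
    rintro m hm ⟨-, h⟩
    have := (cwR (h0 m hm).1 cR).2
    linarith
  have N3 : ∀ m ∈ l3, BtwL b c m → m.port ∉ rightChain C := by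
    rintro m hm ⟨h, -⟩ hR
    have := (cwR (h3 m hm).2 hR).2
    linarith
  refine ⟨l1, l3 ++ l0, ?_, ?_, ?_, ?_⟩
  · have := @List.isRotated_append _ l0 (c :: (l1 ++ b :: l3))
    simpa using this
  · intro m hm
    obtain ⟨mR, h⟩ := cwR (h1 m hm).2 bR
    have h' := (cwR (h1 m hm).1 mR).2
    refine ⟨?_, h, h'⟩
    by_contra hl
    have mL := (hch m (by simp [hm])).1 (by simpa using hl)
    exact Wlem hC mL mR bR.1 cR.1 h h'
  · intro m hm
    rcases List.mem_append.1 hm with hm | hm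
    · rintro ⟨hl, hbt⟩
      exact N3 m hm hbt ((hch m (by simp [hm])).2 hl)
    · rintro ⟨-, hbt⟩
      exact N0 m hm hbt
  · rw [List.pairwise_append]
    refine ⟨?_, ?_, ?_⟩
    · refine p3.imp_of_mem ?_
      intro m n hm hn hmn bm bn
      exact (cwL hmn (N3 m hm bm)).2.2.2.le
    · refine p0.imp_of_mem ?_
      intro m n hm hn hmn bm bn
      exact absurd bm (N0 m hm)
    · intro m hm n hn _ bn
      exact absurd bn (N0 n hn)

lemma bm_lt {C : Set Pt} (hC : IsContour C) {b m c : Pt} (h : CwLT C b m) (bL : b ∈ leftChain C)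
    (mR : m ∉ rightChain C) (hc : c ∈ C) (hy : b.2 < c.2) : b.2 < m.2 := by
  rcases h with h | h | h
  · exact absurd h.2.1 mR
  · by_contra hh
    push Not at hh
    rcases hh.lt_or_eq with hh | hh
    · exact Wlem hC bL h.1 h.2.1.1 hc hh hy
    · exact mR (left_eq h.2.1 bL hh ▸ h.1)
  · exact h.2.2.2.2

lemma decL {C : Set Pt} (hC : IsContour C) {L : List Label}
    (hpw : L.Pairwise (fun a b => CwLT C a.port b.port)) (hch : PortsOnChains C L)
    {b c : Label} (hb : b ∈ L) (hc : c ∈ L) (lb : b.isLeft = true) (lc : c.isLeft = true)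
    (hy : b.port.2 < c.port.2) :
    ∃ l1 l2, L ~r (b :: (l1 ++ c :: l2)) ∧ (∀ m ∈ l1, m.isLeft = true ∧ BtwL b c m) ∧
      (∀ m ∈ l2, ¬ (m.isLeft = true ∧ BtwL b c m)) ∧
      l2.Pairwise (fun m n => BtwL b c m → BtwL b c n → n.port.2 ≤ m.port.2) := by
  have bL := (hch b hb).1 lb
  have cL := (hch c hc).1 lc
  have hne : b ≠ c := by rintro rfl; exact lt_irrefl _ hy
  have isl : ∀ m ∈ L, m.port ∉ rightChain C → m.isLeft = true := by
    intro m hm h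
    by_contra hl
    exact h ((hch m hm).2 (by simpa using hl))
  have after : ∀ m : Label, CwLT C b.port m.port → m.port ∉ rightChain C := by
    intro m h mR
    obtain ⟨bR, hh⟩ := cwR h mR
    exact Wlem hC bL bR mR.1 cL.1 hh hy
  have before : ∀ m : Label, CwLT C m.port b.port → BtwL b c m → m.port ∈ rightChain C := by
    intro m h hbt
    by_contra mR
    have := (cwL h mR).2.2.2
    linarith [hbt.1]
  rcases two_split hb hc hne with ⟨l0, l1, l3, rfl⟩ | ⟨l0, l1, l3, rfl⟩
  · obtain ⟨hbc, h0, h1, h3, p0, p1, p3⟩ := pw_split hpw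
    have cR : c.port ∉ rightChain C := fun h => by linarith [(cwR hbc h).2]
    have N3 : ∀ m ∈ l3, ¬ BtwL b c m := by
      rintro m hm ⟨-, h⟩
      linarith [(cwL (h3 m hm).2 cR).2.2.2]
    refine ⟨l1, l3 ++ l0, ?_, ?_, ?_, ?_⟩
    · have := @List.isRotated_append _ l0 (b :: (l1 ++ c :: l3))
      simpa using this
    · intro m hm
      have mR := after m (h1 m hm).1
      exact ⟨isl m (by simp [hm]) mR, bm_lt hC (h1 m hm).1 bL mR cL.1 hy,
        (cwL (h1 m hm).2 mR).2.2.2⟩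
    · intro m hm
      rcases List.mem_append.1 hm with hm | hm
      · rintro ⟨-, hbt⟩
        exact N3 m hm hbt
      · rintro ⟨hl, hbt⟩
        exact Wlem hC ((hch m (by simp [hm])).1 hl) (before m (h0 m hm).1 hbt) bL.1 cL.1 hbt.1 hbt.2
    · rw [List.pairwise_append]
      refine ⟨?_, ?_, ?_⟩
      · refine p3.imp_of_mem ?_
        intro m n hm hn hmn bm bn
        exact absurd bm (N3 m hm)
      · refine p0.imp_of_mem ?_
        intro m n hm hn hmn bm bn
        exact (cwR hmn (before n (h0 n hn).1 bn)).2.le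
      · intro m hm n hn bm _
        exact absurd bm (N3 m hm)
  · obtain ⟨hcb, h0, h1, h3, p0, p1, p3⟩ := pw_split hpw
    have cR : c.port ∈ rightChain C := by
      by_contra cR
      linarith [(cwL hcb cR).2.2.2]
    refine ⟨l3 ++ l0, l1, ?_, ?_, ?_, ?_⟩
    · have := @List.isRotated_append _ (l0 ++ c :: l1) (b :: l3)
      simpa using this
    · intro m hm
      rcases List.mem_append.1 hm with hm | hm
      · have mR := after m (h3 m hm).2
        have hl := isl m (by simp [hm]) mR
        have mL := (hch m (by simp [hm])).1 hl
        refine ⟨hl, bm_lt hC (h3 m hm).2 bL mR cL.1 hy, ?_⟩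
        by_contra hh
        push Not at hh
        rcases hh.lt_or_eq with hh | hh
        · exact Wlem hC cL cR bL.1 mL.1 hy hh
        · exact mR (left_eq cL mL hh ▸ cR)
      · exfalso
        obtain ⟨mR, hh⟩ := cwR (h0 m hm).1 cR
        exact Wlem hC cL cR bL.1 mR.1 hy hh
    · rintro m hm ⟨hl, hbt⟩
      exact Wlem hC ((hch m (by simp [hm])).1 hl) (before m (h1 m hm).2 hbt) bL.1 cL.1 hbt.1 hbt.2
    · refine p1.imp_of_mem ?_
      intro m n hm hn hmn bm bn
      exact (cwR hmn (before n (h1 n hn).2 bn)).2.le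

structure Env (C : Set Pt) (S : Finset Pt) (L : List Label) : Prop where
  hC : IsContour C
  hS : ∀ s ∈ S, s ∈ C
  valid : ∀ m ∈ L, IsLabel C m
  nd : L.Nodup
  sites : ∀ m ∈ L, m.site ∈ S
  pw : L.Pairwise (fun a b => CwLT C a.port b.port)
  ch : PortsOnChains C L
  stair : ∀ a b, Consecutive L a b → ∀ z, z ∈ a.toSet → z ∈ b.baseline → False
  ass : ∀ m ∈ L, ∀ z, z ∈ m.box → z ∈ convexHull ℝ (S : Set Pt) → False
  lead : ∀ a ∈ L, ∀ b ∈ L, a ≠ b → ∀ z, z ∈ a.leader → z ∈ b.leader → False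
  cons : ∀ a b, Consecutive L a b → a ≠ b → ∀ z, z ∈ a.toSet → z ∈ b.toSet → False

section
variable {C : Set Pt} {S : Finset Pt} {L : List Label}

lemma Env.tri (E : Env C S L) : TriL L := by
  intro x y z h
  have := E.pw.sublist h
  simp at this
  exact cw_tri E.hC.convex this.1.1 this.2

lemma Env.port (E : Env C S L) {x y : Label} (hx : x ∈ L) (hy : y ∈ L) (h : x.port = y.port) :
    x = y := by
  by_contra hne
  have hpw := E.pw
  rcases two_split hx hy hne with ⟨l0, l1, l3, rfl⟩ | ⟨l0, l1, l3, rfl⟩ <;>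
  · have := (pw_split hpw).1
    rw [h] at this
    exact cw_irrefl this

lemma Env.portC (E : Env C S L) {x : Label} (hx : x ∈ L) : x.port ∈ C :=
  (E.valid x hx).leader_in (right_mem_segment ℝ _ _)

lemma Env.hullC (E : Env C S L) : convexHull ℝ (S : Set Pt) ⊆ C :=
  convexHull_min (fun s hs => E.hS s hs) E.hC.convex

lemma Env.hull (E : Env C S L) {x : Label} (hx : x ∈ L) : x.site ∈ convexHull ℝ (S : Set Pt) :=
  subset_convexHull ℝ _ (E.sites x hx)

lemma Env.chL (E : Env C S L) {x : Label} (hx : x ∈ L) (h : x.isLeft = true) : LCh C x.port :=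
  ((E.ch x hx).1 h).2.2

lemma Env.chR (E : Env C S L) {x : Label} (hx : x ∈ L) (h : x.isLeft = false) : RCh C x.port :=
  ((E.ch x hx).2 h).2.2

lemma Env.conLB (E : Env C S L) {a b : Label} (h : Consecutive L a b) (hne : a ≠ b) :
    ∀ z, z ∈ a.leader → z ∈ b.box → False :=
  fun z h1 h2 => E.cons a b h hne z (Or.inr h1) (Or.inl h2)

lemma rot_ne {l1 l2 : List Label} {u v m : Label} (hn : L.Nodup)
    (hr : L ~r (u :: (l1 ++ v :: l2))) (hm : m ∈ l1 ∨ m ∈ l2) : m ≠ u ∧ m ≠ v := by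
  have nd : (u :: (l1 ++ v :: l2)).Nodup := hr.nodup_iff.1 hn
  constructor
  · rintro rfl
    apply (List.nodup_cons.1 nd).1
    rcases hm with hm | hm <;> simp [hm]
  · rintro rfl
    have h := (List.nodup_cons.1 nd).2
    rw [List.nodup_append, List.nodup_cons] at h
    rcases hm with hm | hm
    · exact h.2.2 m hm m (by simp) rfl
    · exact h.2.1.1 hm

lemma rot_in {l1 l2 : List Label} {u v m : Label}
    (hr : L ~r (u :: (l1 ++ v :: l2))) (hm : m ∈ l1 ∨ m ∈ l2) : m ∈ L := by
  rw [hr.mem_iff]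
  rcases hm with hm | hm <;> simp [hm]

noncomputable def toR (m : Label) : RL :=
  ⟨m.site, m.port, m.lo.2, m.hi.2, m.hi.1, decide (m.site.2 ≤ m.port.2)⟩

lemma toR_In {m : Label} (hm : IsLabel C m) (hl : m.isLeft = false) (z : Pt) :
    (toR m).In z ↔ z ∈ m.box := by
  have := (hm.right_ok hl).1
  unfold RL.In toR Label.box
  rw [Set.mem_Icc, Prod.le_def, Prod.le_def]
  simp only [this]
  tauto

lemma toR_base {m : Label} (hl : m.isLeft = false) (z : Pt) (h : z.2 = (toR m).h)
    (h' : (toR m).w ≤ z.1) : z ∈ m.baseline := by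
  unfold Label.baseline
  unfold RL.h toR at *
  by_cases hs : m.site.2 ≤ m.port.2
  · simp [hs, hl] at h ⊢
    exact ⟨h, h'⟩
  · simp [hs, hl] at h ⊢
    exact ⟨h, h'⟩

lemma open_box {m : Label} {q : Pt} (h1 : m.lo.1 < q.1) (h2 : q.1 < m.hi.1) (h3 : m.lo.2 < q.2)
    (h4 : q.2 < m.hi.2) : q ∈ interior m.box := by
  have : (Set.Ioo m.lo.1 m.hi.1 ×ˢ Set.Ioo m.lo.2 m.hi.2 : Set Pt) ⊆ m.box := by
    rintro ⟨x, y⟩ ⟨hx, hy⟩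
    exact ⟨⟨hx.1.le, hy.1.le⟩, ⟨hx.2.le, hy.2.le⟩⟩
  exact interior_maximal this (isOpen_Ioo.prod isOpen_Ioo) ⟨⟨h1, h2⟩, ⟨h3, h4⟩⟩

lemma Env.out (E : Env C S L) {m : Label} (hm : m ∈ L) {q : Pt} (hq : q ∈ C) (h1 : m.lo.1 < q.1)
    (h2 : q.1 < m.hi.1) (h3 : m.lo.2 < q.2) (h4 : q.2 < m.hi.2) : False := by
  have := (E.valid m hm).box_out
  have h : q ∈ interior m.box ∩ C := ⟨open_box h1 h2 h3 h4, hq⟩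
  rw [this] at h
  exact h

lemma toR_ok (E : Env C S L) {m : Label} (hm : m ∈ L) (hl : m.isLeft = false) : (toR m).Ok C := by
  obtain ⟨e1, e2, e3⟩ := (E.valid m hm).right_ok hl
  refine ⟨E.hS _ (E.sites m hm), E.portC hm, E.chR hm hl, e2, e3, ?_, ?_, ?_, ?_⟩
  · show m.port.1 ≤ m.hi.1
    rw [e1]; exact (E.valid m hm).lo_le_hi.1
  · intro q hq h1 h2 h3 h4
    exact E.out hm hq (by rw [← e1]; exact h1) h2 h3 h4
  · intro h
    simpa [toR] using h
  · intro h
    simp [toR] at h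
    exact h.le

lemma seg_hull (E : Env C S L) {a b : Label} (ha : a ∈ L) (hb : b ∈ L) {z : Pt}
    (hz : z ∈ segment ℝ a.site b.site) : z ∈ convexHull ℝ (S : Set Pt) :=
  (convex_convexHull ℝ _).segment_subset (E.hull ha) (E.hull hb) hz

lemma toR_hp (E : Env C S L) {a b : Label} (ha : a ∈ L) (hb : b ∈ L) (la : a.isLeft = false)
    (lb : b.isLeft = false) (hne : a ≠ b) (hc : Consecutive L a b) : HP (toR a) (toR b) := by
  have ia := toR_In (E.valid a ha) la
  have ib := toR_In (E.valid b hb) lb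
  refine ⟨?_, ?_, ?_, ?_, ?_⟩
  · intro z h1 h2
    exact E.cons a b hc hne z (Or.inl ((ia z).1 h1)) (Or.inl ((ib z).1 h2))
  · intro z h1 h2
    exact E.cons a b hc hne z (Or.inr h1) (Or.inl ((ib z).1 h2))
  · intro z h1 h2 h3
    exact E.stair a b hc z (Or.inl ((ia z).1 h1)) (toR_base lb z h2 h3)
  · intro z h1 h2 h3
    exact E.stair a b hc z (Or.inr h1) (toR_base lb z h2 h3)
  · intro z h1 h2
    exact E.ass b hb z ((ib z).1 h2) (seg_hull E ha hb h1)

lemma Env.mainR (E : Env C S L) {c b : Label} (hc : c ∈ L) (hb : b ∈ L) (lc : c.isLeft = false)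
    (lb : b.isLeft = false) (hy : b.port.2 < c.port.2) (hadj : ¬ Consecutive L c b) (z : Pt)
    (zc : z ∈ c.box) (zb : z ∈ b.box) : False := by
  have memI : ∀ m, m ∈ L.toFinset.filter (fun m => m.isLeft = false) ↔ m ∈ L ∧ m.isLeft = false := by
    intro m; simp
  refine absT (L.toFinset.filter (fun m => m.isLeft = false)) toR (Consecutive L)
    (C := C) (K := convexHull ℝ (S : Set Pt)) E.hC.convex
    (convex_convexHull ℝ _) ?_ ?_ (fun i j h => Or.symm h) ?_ c ((memI c).2 ⟨hc, lc⟩) b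
    ((memI b).2 ⟨hb, lb⟩) hy hadj z ((toR_In (E.valid c hc) lc z).2 zc)
    ((toR_In (E.valid b hb) lb z).2 zb)
  · intro i hi
    obtain ⟨hi, li⟩ := (memI i).1 hi
    exact toR_ok E hi li
  · intro i hi j hj hne h
    obtain ⟨hi, li⟩ := (memI i).1 hi
    obtain ⟨hj, lj⟩ := (memI j).1 hj
    exact toR_hp E hi hj li lj hne h
  clear hc hb lc lb hy hadj zc zb
  intro c hc b hb hy hadj
  obtain ⟨hc, lc⟩ := (memI c).1 hc
  obtain ⟨hb, lb⟩ := (memI b).1 hb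
  have ic := toR_In (E.valid c hc) lc
  have ib := toR_In (E.valid b hb) lb
  obtain ⟨l1, l2, hr, A1, A2, A3⟩ := decR E.hC E.pw E.ch hb hc lb lc hy
  obtain ⟨P1, mP1, Q1, mQ1, P2, mP2, Q2, mQ2, n1, n2, n3, n4, o1, o2, o3, o4, od, u1, u2⟩ :=
    arcG E.nd E.tri hr hadj
  have inL := fun m h => rot_in (m := m) hr h
  have ne := fun m h => rot_ne (m := m) E.nd hr h
  have inl1 : ∀ m ∈ L, m.isLeft = false → BtwL b c m → m ∈ l1 := by
    intro m hm lm hbt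
    rw [hr.mem_iff] at hm
    simp only [List.mem_cons, List.mem_append] at hm
    rcases hm with rfl | hm | rfl | hm
    · exact absurd hbt.2 (lt_irrefl _)
    · exact hm
    · exact absurd hbt.1 (lt_irrefl _)
    · exact absurd ⟨lm, hbt⟩ (A2 m hm)
  have z2 : ∀ m ∈ l2, LCh C m.port ∨ ¬ (b.port.2 < m.port.2 ∧ m.port.2 < c.port.2) := by
    intro m hm
    cases lm : m.isLeft with
    | true => exact Or.inl (E.chL (inL m (Or.inr hm)) lm)
    | false => exact Or.inr fun h => A2 m hm ⟨lm, h⟩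
  have dd : ∀ a ∈ L, ∀ b ∈ L, (toR a).sp = (toR b).sp ∨
      ∀ z, z ∈ segment ℝ (toR a).sp.1 (toR a).sp.2 → z ∈ segment ℝ (toR b).sp.1 (toR b).sp.2 →
        False := by
    intro a ha b hb
    by_cases h : a = b
    · exact Or.inl (by rw [h])
    · exact Or.inr (E.lead a ha b hb h)
  refine ⟨P1, (memI _).2 ⟨inL _ (Or.inl mP1), (A1 _ mP1).1⟩, Q1,
    (memI _).2 ⟨inL _ (Or.inl mQ1), (A1 _ mQ1).1⟩, (toR P2).sp, (toR Q2).sp, ?_, ?_, ?_⟩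
  · have iP1 := inL P1 (Or.inl mP1)
    have iQ1 := inL Q1 (Or.inl mQ1)
    have iP2 := inL P2 (Or.inr mP2)
    have iQ2 := inL Q2 (Or.inr mQ2)
    exact {
      KC := E.hullC
      Kb := fun k hk h => E.ass b hb k ((ib k).1 h) hk
      Kc := fun k hk h => E.ass c hc k ((ic k).1 h) hk
      sm1 := E.hull iP1
      sn1 := E.hull iQ1
      sm2 := E.hull iQ2
      sn2 := E.hull iP2
      pm1 := E.portC iP1
      pn1 := E.portC iQ1
      pm2 := E.portC iQ2
      pn2 := E.portC iP2
      rm1 := E.chR iP1 (A1 _ mP1).1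
      rn1 := E.chR iQ1 (A1 _ mQ1).1
      ym1 := (A1 _ mP1).2
      yn1 := (A1 _ mQ1).2
      zm2 := z2 _ mQ2
      zn2 := z2 _ mP2
      ln1 := fun z h h' => E.conLB (Or.inl n2) (ne _ (Or.inl mQ1)).2 z h ((ib z).1 h')
      ln2 := fun z h h' => E.conLB (Or.inr n3) (ne _ (Or.inr mP2)).2 z h ((ib z).1 h')
      lm1 := fun z h h' => E.conLB (Or.inr n1) (ne _ (Or.inl mP1)).1 z h ((ic z).1 h')
      lm2 := fun z h h' => E.conLB (Or.inl n4) (ne _ (Or.inr mQ2)).1 z h ((ic z).1 h')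
      o1 := o2
      o2 := o1
      o3 := o3
      o4 := o4
      d1 := dd _ iP1 _ iQ1
      d2 := dd _ iQ2 _ iP2
      deg := by
        intro h1 h2 h3 h4
        rcases od _ A3 with h | h
        · rw [h]
        · exact h ⟨h1, h2⟩ ⟨h3, h4⟩
      ne1 := fun h => (ne _ (Or.inr mP2)).1 (E.port iP2 hc h)
      ne2 := fun h => (ne _ (Or.inr mQ2)).2 (E.port iQ2 hb h) }
  · intro m hm ma h1 h2
    obtain ⟨hm, lm⟩ := (memI m).1 hm
    exact u2 m (inl1 m hm lm ⟨h1, h2⟩) ma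
  · intro m hm ma h1 h2
    obtain ⟨hm, lm⟩ := (memI m).1 hm
    exact u1 m (inl1 m hm lm ⟨h1, h2⟩) ma

/-- mirrored version -/
def mx (q : Pt) : Pt := (-q.1, q.2)

def mX (C : Set Pt) : Set Pt := {q | mx q ∈ C}

lemma mx_mx (q : Pt) : mx (mx q) = q := by simp [mx]

lemma mem_mX {q : Pt} (h : q ∈ C) : mx q ∈ mX C := by
  show mx (mx q) ∈ C
  rwa [mx_mx]

lemma mX_convex (hC : Convex ℝ C) : Convex ℝ (mX C) := by
  intro a ha b hb x y hx hy hxy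
  have := hC ha hb hx hy hxy
  show mx _ ∈ C
  convert this using 1
  ext <;> simp [mx]
  ring

lemma seg_mx {a b z : Pt} (h : z ∈ segment ℝ (mx a) (mx b)) : mx z ∈ segment ℝ a b := by
  obtain ⟨x, y, hx, hy, hxy, rfl⟩ := h
  refine ⟨x, y, hx, hy, hxy, ?_⟩
  ext <;> simp [mx]
  ring

lemma cross2_mx (a b c : Pt) : cross2 (mx a) (mx b) (mx c) = cross2 b a c := by
  unfold cross2 mx; ring

lemma LCh.mx {T : Pt} (h : LCh C T) : RCh (mX C) (mx T) := by
  intro q hq h2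
  have := h (_root_.mx q) hq h2
  simp only [_root_.mx] at this ⊢
  linarith

lemma RCh.mx {T : Pt} (h : RCh C T) : LCh (mX C) (mx T) := by
  intro q hq h2
  have := h (_root_.mx q) hq h2
  simp only [_root_.mx] at this ⊢
  linarith

noncomputable def toL (m : Label) : RL :=
  ⟨mx m.site, mx m.port, m.lo.2, m.hi.2, -m.lo.1, decide (m.site.2 ≤ m.port.2)⟩

lemma toL_In {m : Label} (hm : IsLabel C m) (hl : m.isLeft = true) (z : Pt) :
    (toL m).In z ↔ mx z ∈ m.box := by
  have := (hm.left_ok hl).1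
  unfold RL.In toL Label.box
  rw [Set.mem_Icc, Prod.le_def, Prod.le_def]
  simp only [this, mx]
  constructor
  · rintro ⟨h1, h2, h3, h4⟩
    exact ⟨⟨by linarith, h3⟩, ⟨by linarith, h4⟩⟩
  · rintro ⟨⟨h1, h2⟩, ⟨h3, h4⟩⟩
    exact ⟨by linarith, by linarith, h2, h4⟩

lemma toL_base {m : Label} (hl : m.isLeft = true) (z : Pt) (h : z.2 = (toL m).h)
    (h' : (toL m).w ≤ z.1) : mx z ∈ m.baseline := by
  unfold Label.baseline
  unfold RL.h toL at *
  simp only at h'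
  by_cases hs : m.site.2 ≤ m.port.2
  · simp [hs, hl, mx] at h ⊢
    exact ⟨h, by linarith⟩
  · simp [hs, hl, mx] at h ⊢
    exact ⟨h, by linarith⟩

lemma toL_ok (E : Env C S L) {m : Label} (hm : m ∈ L) (hl : m.isLeft = true) :
    (toL m).Ok (mX C) := by
  obtain ⟨e1, e2, e3⟩ := (E.valid m hm).left_ok hl
  refine ⟨mem_mX (E.hS _ (E.sites m hm)), mem_mX (E.portC hm), (E.chL hm hl).mx, e2, e3, ?_, ?_, ?_, ?_⟩
  · show -m.port.1 ≤ -m.lo.1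
    rw [e1]; exact neg_le_neg (E.valid m hm).lo_le_hi.1
  · intro q hq h1 h2 h3 h4
    simp only [toL, mx] at h1 h2 h3 h4
    exact E.out hm hq (by simp only [mx]; linarith) (by simp only [mx]; linarith) h3 h4
  · intro h
    simpa [toL, mx] using h
  · intro h
    simp [toL] at h
    exact h.le

lemma toL_hp (E : Env C S L) {a b : Label} (ha : a ∈ L) (hb : b ∈ L) (la : a.isLeft = true)
    (lb : b.isLeft = true) (hne : a ≠ b) (hc : Consecutive L a b) : HP (toL a) (toL b) := by
  have ia := toL_In (E.valid a ha) la
  have ib := toL_In (E.valid b hb) lb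
  refine ⟨?_, ?_, ?_, ?_, ?_⟩
  · intro z h1 h2
    exact E.cons a b hc hne _ (Or.inl ((ia z).1 h1)) (Or.inl ((ib z).1 h2))
  · intro z h1 h2
    exact E.cons a b hc hne _ (Or.inr (seg_mx h1)) (Or.inl ((ib z).1 h2))
  · intro z h1 h2 h3
    exact E.stair a b hc _ (Or.inl ((ia z).1 h1)) (toL_base lb z h2 h3)
  · intro z h1 h2 h3
    exact E.stair a b hc _ (Or.inr (seg_mx h1)) (toL_base lb z h2 h3)
  · intro z h1 h2
    exact E.ass b hb _ ((ib z).1 h2) (seg_hull E ha hb (seg_mx h1))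

lemma Env.mainL (E : Env C S L) {c b : Label} (hc : c ∈ L) (hb : b ∈ L) (lc : c.isLeft = true)
    (lb : b.isLeft = true) (hy : b.port.2 < c.port.2) (hadj : ¬ Consecutive L c b) (z : Pt)
    (zc : z ∈ c.box) (zb : z ∈ b.box) : False := by
  have memI : ∀ m, m ∈ L.toFinset.filter (fun m => m.isLeft = true) ↔ m ∈ L ∧ m.isLeft = true := by
    intro m; simp
  refine absT (L.toFinset.filter (fun m => m.isLeft = true)) toL (Consecutive L)
    (C := mX C) (K := mX (convexHull ℝ (S : Set Pt))) (mX_convex E.hC.convex)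
    (mX_convex (convex_convexHull ℝ _)) ?_ ?_ (fun i j h => Or.symm h) ?_ c ((memI c).2 ⟨hc, lc⟩) b
    ((memI b).2 ⟨hb, lb⟩) hy hadj (mx z) ((toL_In (E.valid c hc) lc _).2 (by rwa [mx_mx]))
    ((toL_In (E.valid b hb) lb _).2 (by rwa [mx_mx]))
  · intro i hi
    obtain ⟨hi, li⟩ := (memI i).1 hi
    exact toL_ok E hi li
  · intro i hi j hj hne h
    obtain ⟨hi, li⟩ := (memI i).1 hi
    obtain ⟨hj, lj⟩ := (memI j).1 hj
    exact toL_hp E hi hj li lj hne h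
  clear hc hb lc lb hy hadj zc zb
  intro c hc b hb hy hadj
  obtain ⟨hc, lc⟩ := (memI c).1 hc
  obtain ⟨hb, lb⟩ := (memI b).1 hb
  have ic := toL_In (E.valid c hc) lc
  have ib := toL_In (E.valid b hb) lb
  obtain ⟨l1, l2, hr, A1, A2, A3⟩ := decL E.hC E.pw E.ch hb hc lb lc hy
  obtain ⟨P1, mP1, Q1, mQ1, P2, mP2, Q2, mQ2, n1, n2, n3, n4, o1, o2, o3, o4, od, u1, u2⟩ :=
    arcG E.nd E.tri hr (fun h => hadj (Or.symm h))
  have inL := fun m h => rot_in (m := m) hr h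
  have ne := fun m h => rot_ne (m := m) E.nd hr h
  have inl1 : ∀ m ∈ L, m.isLeft = true → BtwL b c m → m ∈ l1 := by
    intro m hm lm hbt
    rw [hr.mem_iff] at hm
    simp only [List.mem_cons, List.mem_append] at hm
    rcases hm with rfl | hm | rfl | hm
    · exact absurd hbt.1 (lt_irrefl _)
    · exact hm
    · exact absurd hbt.2 (lt_irrefl _)
    · exact absurd ⟨lm, hbt⟩ (A2 m hm)
  have z2 : ∀ m ∈ l2, LCh (mX C) (mx m.port) ∨
      ¬ (b.port.2 < m.port.2 ∧ m.port.2 < c.port.2) := by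
    intro m hm
    cases lm : m.isLeft with
    | false => exact Or.inl (E.chR (inL m (Or.inr hm)) lm).mx
    | true => exact Or.inr fun h => A2 m hm ⟨lm, h⟩
  have dd : ∀ a ∈ L, ∀ b ∈ L, (toL a).sp = (toL b).sp ∨
      ∀ z, z ∈ segment ℝ (toL a).sp.1 (toL a).sp.2 → z ∈ segment ℝ (toL b).sp.1 (toL b).sp.2 →
        False := by
    intro a ha b hb
    by_cases h : a = b
    · exact Or.inl (by rw [h])
    · exact Or.inr fun z h1 h2 => E.lead a ha b hb h _ (seg_mx h1) (seg_mx h2)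
  have mxi : ∀ p q : Pt, mx p = mx q → p = q := by
    intro p q h
    rw [← mx_mx p, h, mx_mx]
  refine ⟨Q1, (memI _).2 ⟨inL _ (Or.inl mQ1), (A1 _ mQ1).1⟩, P1,
    (memI _).2 ⟨inL _ (Or.inl mP1), (A1 _ mP1).1⟩, (toL Q2).sp, (toL P2).sp, ?_, ?_, ?_⟩
  · have iP1 := inL P1 (Or.inl mP1)
    have iQ1 := inL Q1 (Or.inl mQ1)
    have iP2 := inL P2 (Or.inr mP2)
    have iQ2 := inL Q2 (Or.inr mQ2)
    exact {
      KC := fun k hk => E.hullC hk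
      Kb := fun k hk h => E.ass b hb _ ((ib k).1 h) hk
      Kc := fun k hk h => E.ass c hc _ ((ic k).1 h) hk
      sm1 := mem_mX (E.hull iQ1)
      sn1 := mem_mX (E.hull iP1)
      sm2 := mem_mX (E.hull iP2)
      sn2 := mem_mX (E.hull iQ2)
      pm1 := mem_mX (E.portC iQ1)
      pn1 := mem_mX (E.portC iP1)
      pm2 := mem_mX (E.portC iP2)
      pn2 := mem_mX (E.portC iQ2)
      rm1 := (E.chL iQ1 (A1 _ mQ1).1).mx
      rn1 := (E.chL iP1 (A1 _ mP1).1).mx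
      ym1 := (A1 _ mQ1).2
      yn1 := (A1 _ mP1).2
      zm2 := z2 _ mP2
      zn2 := z2 _ mQ2
      ln1 := fun z h h' => E.conLB (Or.inr n1) (ne _ (Or.inl mP1)).1 _ (seg_mx h) ((ib z).1 h')
      ln2 := fun z h h' => E.conLB (Or.inl n4) (ne _ (Or.inr mQ2)).1 _ (seg_mx h) ((ib z).1 h')
      lm1 := fun z h h' => E.conLB (Or.inl n2) (ne _ (Or.inl mQ1)).2 _ (seg_mx h) ((ic z).1 h')
      lm2 := fun z h h' => E.conLB (Or.inr n3) (ne _ (Or.inr mP2)).2 _ (seg_mx h) ((ic z).1 h')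
      o1 := (cross2_mx _ _ _).trans_le o1
      o2 := (cross2_mx _ _ _).trans_le o2
      o3 := (cross2_mx _ _ _).trans_le o4
      o4 := (cross2_mx _ _ _).trans_le o3
      d1 := dd _ iQ1 _ iP1
      d2 := dd _ iP2 _ iQ2
      deg := by
        intro h1 h2 h3 h4
        rcases od _ A3 with h | h
        · rw [h]
        · exact h ⟨h3, h4⟩ ⟨h1, h2⟩
      ne1 := fun h => (ne _ (Or.inr mQ2)).2 (E.port iQ2 hc (mxi _ _ h))
      ne2 := fun h => (ne _ (Or.inr mP2)).1 (E.port iP2 hb (mxi _ _ h)) }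
  · intro m hm ma h1 h2
    obtain ⟨hm, lm⟩ := (memI m).1 hm
    exact u1 m (inl1 m hm lm ⟨h1, h2⟩) ma
  · intro m hm ma h1 h2
    obtain ⟨hm, lm⟩ := (memI m).1 hm
    exact u2 m (inl1 m hm lm ⟨h1, h2⟩) ma

lemma Env.ydist (E : Env C S L) {a b : Label} (ha : a ∈ L) (hb : b ∈ L) (hne : a ≠ b)
    (h : a.isLeft = b.isLeft) : a.port.2 ≠ b.port.2 := by
  intro hy
  apply hne
  apply E.port ha hb
  cases lb : b.isLeft with
  | true => exact left_eq ((E.ch a ha).1 (h.trans lb)) ((E.ch b hb).1 lb) hy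
  | false =>
    have ra := (E.ch a ha).2 (h.trans lb)
    have rb := (E.ch b hb).2 lb
    exact Prod.ext (le_antisymm (rb.2.2 _ ra.1 hy) (ra.2.2 _ rb.1 hy.symm)) hy
end

/-- Under the hypotheses of Lemma 1, the text boxes of any two
non-consecutive labels lying on the same side are disjoint. -/
theorem statement_7
    (C : Set Pt) (t : Pt) (S : Finset Pt) (L : List Label)
    (hC : IsContour C) (ht : IsTopmost C t)
    (hSin : ∀ s ∈ S, s ∈ interior C) (hgen : GenPos S)
    (hlab : IsContourLabeling C S L)
    (hchains : PortsOnChains C L)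
    (hstair : IsStaircase L)
    (hassum : Assumption1 S L)
    (hleaders : LeadersDisjoint L)
    (hcons : ConsecutiveDisjoint L) :
    ∀ a ∈ L, ∀ b ∈ L, a ≠ b → ¬ Consecutive L a b → a.isLeft = b.isLeft →
      a.box ∩ b.box = ∅ := by
  have E : Env C S L := by
    refine ⟨hC, fun s hs => interior_subset (hSin s hs), hlab.valid, hlab.nodup_sites.of_map _,
      fun m hm => (hlab.sites_iff _).2 (List.mem_map_of_mem hm), ?_, hchains, ?_, ?_, ?_, ?_⟩
    · have : IsTrans Label (fun a b => CwLT C a.port b.port) := ⟨fun _ _ _ h h' => cw_trans h h'⟩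
      exact List.isChain_iff_pairwise.1 hlab.radial
    · intro a b h z h1 h2
      exact Set.eq_empty_iff_forall_notMem.1 (hstair a b h).1 z ⟨h1, h2⟩
    · intro m hm z h1 h2
      exact Set.eq_empty_iff_forall_notMem.1 (hassum m hm) z ⟨h1, h2⟩
    · intro a ha b hb hne z h1 h2
      have hl : L.Pairwise (fun a b => a.leader ∩ b.leader = ∅) := hleaders
      rcases two_split ha hb hne with ⟨l0, l1, l3, e⟩ | ⟨l0, l1, l3, e⟩ <;> rw [e] at hl
      · exact Set.eq_empty_iff_forall_notMem.1 (pw_split hl).1 z ⟨h1, h2⟩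
      · exact Set.eq_empty_iff_forall_notMem.1 (pw_split hl).1 z ⟨h2, h1⟩
    · intro a b h hne z h1 h2
      exact Set.eq_empty_iff_forall_notMem.1 (hcons a b h hne) z ⟨h1, h2⟩
  intro a ha b hb hne hadj hs
  refine Set.eq_empty_iff_forall_notMem.2 ?_
  rintro z ⟨za, zb⟩
  have hadj' : ¬ Consecutive L b a := fun h => hadj (Or.symm h)
  rcases lt_or_gt_of_ne (E.ydist ha hb hne hs) with hy | hy
  · cases lb : b.isLeft with
    | true => exact E.mainL hb ha lb (hs.trans lb) hy hadj' z zb za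
    | false => exact E.mainR hb ha lb (hs.trans lb) hy hadj' z zb za
  · cases lb : b.isLeft with
    | true => exact E.mainL ha hb (hs.trans lb) lb hy hadj z za zb
    | false => exact E.mainR ha hb (hs.trans lb) lb hy hadj z za zb
end

section
/- Let C be a contour with site set S, and let L be a staircase contour labeling of (C,S) satisfying Assumption 1, in which every left label has its port on C_L and every right label has its port on C_R, no two leaders of L intersect, and no two consecutive labels of L intersect. Then for any two non-consecutive labels ℓ and ℓ' of L, the leader of ℓ' is disjoint from the text box of ℓ. -/
open scoped Classical
structure Cfg (C I : ℝ → ℝ → Prop) (p1 p2 lo hi q2 s1 s2 e1 e2 θ a1 a2 b1 b2 : ℝ) : Prop where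
  hIC : ∀ x y, I x y → C x y
  hconv : ∀ a b c d t, 0 ≤ t → t ≤ 1 → C a b → C c d → C (t*a+(1-t)*c) (t*b+(1-t)*d)
  hint : ∀ a b c d t, 0 < t → t ≤ 1 → I a b → C c d → I (t*a+(1-t)*c) (t*b+(1-t)*d)
  hlp : lo ≤ p2
  hph : p2 ≤ hi
  hlq : lo ≤ q2
  hqh : q2 ≤ hi
  hp : C p1 p2
  hpI : ¬ I p1 p2
  hs : I s1 s2
  he : C e1 e2
  heI : ¬ I e1 e2
  hθ : 0 < θ
  hθ1 : θ ≤ 1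
  hq1 : p1 = s1 + θ * (e1 - s1)
  hq2 : q2 = s2 + θ * (e2 - s2)
  ha : I a1 a2
  hb : C b1 b2
  hbI : ¬ I b1 b2
  hull : ∀ t, 0 ≤ t → t ≤ 1 → t*s1+(1-t)*a1 = p1 → lo ≤ t*s2+(1-t)*a2 →
    t*s2+(1-t)*a2 ≤ hi → False
  nb : ∀ t, 0 ≤ t → t ≤ 1 → t*a1+(1-t)*b1 = p1 → lo ≤ t*a2+(1-t)*b2 →
    t*a2+(1-t)*b2 ≤ hi → False
  nl : ∀ t r, 0 ≤ t → t ≤ 1 → 0 ≤ r → r ≤ 1 → t*a1+(1-t)*b1 = r*s1+(1-r)*e1 →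
    t*a2+(1-t)*b2 = r*s2+(1-r)*e2 → False

def TwoNeg (x y z : ℝ) : Prop := (x < 0 ∧ y < 0) ∨ (y < 0 ∧ z < 0) ∨ (x < 0 ∧ z < 0)

set_option maxHeartbeats 2000000 in
theorem Cfg.core {C I : ℝ → ℝ → Prop} {p1 p2 lo hi q2 s1 s2 e1 e2 θ a1 a2 b1 b2 : ℝ}
    (h : Cfg C I p1 p2 lo hi q2 s1 s2 e1 e2 θ a1 a2 b1 b2)
    (hs : p1 < s1) (hq : p2 < q2)
    (hX : TwoNeg ((b1-p1)*(s2-p2)-(b2-p2)*(s1-p1)) ((e1-b1)*(s2-b2)-(e2-b2)*(s1-b1))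
      ((p1-e1)*(s2-e2)-(p2-e2)*(s1-e1))) : False := by
  obtain ⟨hIC, hconv, hint, hlp, hph, hlq, hqh, hp, hpI, hsI, he, heI, hθ, hθ1, hq1, hq2,
    ha, hb, hbI, hull, nb, nl⟩ := h
  -- q in C
  have hqC : C p1 q2 := by
    have := hconv e1 e2 s1 s2 θ hθ.le hθ1 he (hIC _ _ hsI)
    convert this using 1
    · rw [hq1]; ring
    · rw [hq2]; ring
  -- no interior point on the vertical line below p
  have below : ∀ y, I p1 y → y < p2 → False := by
    intro y hy hlt
    apply hpI
    have hd : 0 < q2 - y := by linarith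
    have := hint p1 y p1 q2 ((q2 - p2)/(q2-y)) (by apply div_pos <;> linarith)
      (by rw [div_le_one hd]; linarith) hy hqC
    convert this using 1
    · ring
    · field_simp; ring
  obtain ⟨m, hm⟩ : ∃ m, m * (s1 - p1) = s2 - q2 := ⟨(s2-q2)/(s1-p1), by
    have : s1 - p1 ≠ 0 := by linarith
    field_simp⟩
  have hes : 0 < s1 - e1 := by nlinarith
  have hep : (s1 - p1) = θ * (s1 - e1) := by rw [hq1]; ring
  have hem : m * (s1 - e1) = s2 - e2 := by
    have h1 : θ * (m * (s1 - e1)) = θ * (s2 - e2) := by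
      have : m * (θ * (s1 - e1)) = s2 - q2 := by rw [← hep]; exact hm
      rw [hq2] at this; linarith
    exact mul_left_cancel₀ hθ.ne' h1
  have hs2 : s2 = q2 + m * (s1 - p1) := by linarith
  have he2 : e2 = q2 + m * (e1 - p1) := by linarith
  have X3 : 0 < (p1-e1)*(s2-e2)-(p2-e2)*(s1-e1) := by
    have : (p1-e1)*(s2-e2)-(p2-e2)*(s1-e1) = (q2 - p2) * (s1 - e1) := by
      rw [hs2, he2]; ring
    rw [this]; apply mul_pos <;> linarith
  have X1 : (b1-p1)*(s2-p2)-(b2-p2)*(s1-p1) < 0 := by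
    rcases hX with h | h | h
    · exact h.1
    · exact absurd h.2 (by linarith)
    · exact h.1
  have X2 : (e1-b1)*(s2-b2)-(e2-b2)*(s1-b1) < 0 := by
    rcases hX with h | h | h
    · exact h.2
    · exact h.1
    · exact absurd h.2 (by linarith)
  -- b strictly below the line
  have gb : b2 - q2 - m * (b1 - p1) < 0 := by
    have : (e1-b1)*(s2-b2)-(e2-b2)*(s1-b1) = (b2 - q2 - m * (b1 - p1)) * (s1 - e1) := by
      rw [hs2, he2]; ring
    rw [this] at X2
    by_contra hcon
    push Not at hcon
    have := mul_nonneg hcon hes.le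
    linarith
  have hsp : 0 < s1 - p1 := by linarith
  have hb1 : b1 < p1 := by
    by_contra hcon
    push Not at hcon
    rcases hcon.eq_or_lt with heq | hlt
    · -- b on vertical line
      subst heq
      have h1 : p2 < b2 := by nlinarith
      have h2 : b2 < q2 := by linarith
      exact nb 0 le_rfl zero_le_one (by ring) (by linarith) (by linarith)
    · have hbs : b1 < s1 := by
        by_contra hc
        push Not at hc
        -- b2*(s1-p1) > ...
        have h1 : (b2 - q2 - m * (b1 - p1)) * (s1 - p1) < 0 := mul_neg_of_neg_of_pos gb hsp
        have h2 : 0 ≤ (q2 - p2) * (b1 - s1) := by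
          apply mul_nonneg <;> linarith
        rw [hs2] at X1
        nlinarith
      apply hbI
      obtain ⟨κ, hκ⟩ : ∃ κ, κ = (b1 - p1)/(s1 - p1) := ⟨_, rfl⟩
      have hκ' : κ * (s1 - p1) = b1 - p1 := by rw [hκ]; field_simp
      have hκ0 : 0 < κ := by rw [hκ]; apply div_pos <;> linarith
      have hκ1 : κ < 1 := by rw [hκ, div_lt_one hsp]; linarith
      obtain ⟨w, hw⟩ : ∃ w, w = (b2 - κ * s2)/(1 - κ) := ⟨_, rfl⟩
      have h1κ : 0 < 1 - κ := by linarith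
      have hw' : (1 - κ) * w = b2 - κ * s2 := by rw [hw]; field_simp
      have hwq : w < q2 := by
        have : (1-κ) * w < (1-κ) * q2 := by
          rw [hw', hs2]
          have : m * (b1 - p1) = κ * (m * (s1 - p1)) := by rw [← hκ']; ring
          nlinarith
        exact lt_of_mul_lt_mul_left this h1κ.le
      have hwp : p2 < w := by
        have : (1-κ) * p2 < (1-κ) * w := by
          rw [hw']
          rw [← hκ'] at X1
          have : (s1 - p1) * ((1-κ) * p2 - (b2 - κ * s2)) < 0 := by linarith
          by_contra hc
          push Not at hc
          have := mul_nonneg hsp.le (sub_nonneg.2 hc)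
          linarith
        exact lt_of_mul_lt_mul_left this h1κ.le
      have hwC : C p1 w := by
        have hd : 0 < q2 - p2 := by linarith
        have := hconv p1 q2 p1 p2 ((w-p2)/(q2-p2)) (by apply div_nonneg <;> linarith)
          (by rw [div_le_one hd]; linarith) hqC hp
        convert this using 1
        · ring
        · field_simp; ring
      have := hint s1 s2 p1 w κ hκ0 hκ1.le hsI hwC
      convert this using 1 <;> linarith
  -- a point z of the leader above the line
  obtain ⟨t0, ht0, ht1, hz1, hz2⟩ : ∃ t, 0 ≤ t ∧ t ≤ 1 ∧ t*a1+(1-t)*b1 ≤ p1 ∧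
      0 < (t*a2+(1-t)*b2) - q2 - m * ((t*a1+(1-t)*b1) - p1) := by
    rcases le_or_gt a1 p1 with hap | hap
    · refine ⟨1, zero_le_one, le_rfl, by linarith, ?_⟩
      have hd : 0 < s1 - a1 := by linarith
      obtain ⟨t, ht⟩ : ∃ t, t = (p1 - a1)/(s1-a1) := ⟨_, rfl⟩
      have ht0 : 0 ≤ t := by rw [ht]; apply div_nonneg <;> linarith
      have ht1 : t < 1 := by rw [ht, div_lt_one hd]; linarith
      have ht' : t * (s1 - a1) = p1 - a1 := by rw [ht]; field_simp
      have hx : t*s1+(1-t)*a1 = p1 := by linarith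
      have hzI : I p1 (t*s2+(1-t)*a2) := by
        have := hint a1 a2 s1 s2 (1-t) (by linarith) (by linarith) ha (hIC _ _ hsI)
        convert this using 1 <;> linarith
      have hnb := below _ hzI
      have hzq : q2 < t*s2+(1-t)*a2 := by
        by_contra hc
        push Not at hc
        rcases lt_or_ge (t*s2+(1-t)*a2) p2 with hl | hl
        · exact hnb hl
        · exact hull t ht0 ht1.le hx (by linarith) (by linarith)
      have : 0 < (1-t) * (a2 - q2 - m * (a1 - p1)) := by
        have e : (1-t) * (a2 - q2 - m * (a1 - p1)) = t*s2+(1-t)*a2 - q2 := by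
          have : (1-t) * (a1 - p1) = - t * (s1 - p1) := by linarith
          have : (1-t) * (m * (a1 - p1)) = - t * (m * (s1 - p1)) := by
            linear_combination m * this
          rw [hs2]; linarith
        rw [e]; linarith
      have := pos_of_mul_pos_right this (by linarith)
      linarith
    · have hd : 0 < a1 - b1 := by linarith
      obtain ⟨t, ht⟩ : ∃ t, t = (p1 - b1)/(a1-b1) := ⟨_, rfl⟩
      have ht0 : 0 < t := by rw [ht]; apply div_pos <;> linarith
      have ht1 : t ≤ 1 := by rw [ht, div_le_one hd]; linarith
      have ht' : t * (a1 - b1) = p1 - b1 := by rw [ht]; field_simp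
      have hx : t*a1+(1-t)*b1 = p1 := by linarith
      refine ⟨t, ht0.le, ht1, hx.le, ?_⟩
      have hzI : I p1 (t*a2+(1-t)*b2) := by
        have := hint a1 a2 b1 b2 t ht0 ht1 ha hb
        rwa [hx] at this
      have hnb := below _ hzI
      have hzq : q2 < t*a2+(1-t)*b2 := by
        by_contra hc
        push Not at hc
        rcases lt_or_ge (t*a2+(1-t)*b2) p2 with hl | hl
        · exact hnb hl
        · exact nb t ht0.le ht1 hx (by linarith) (by linarith)
      rw [hx]; linarith
  obtain ⟨G, hG⟩ : ∃ G, G = (t0*a2+(1-t0)*b2) - q2 - m * ((t0*a1+(1-t0)*b1) - p1) := ⟨_, rfl⟩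
  obtain ⟨B, hB⟩ : ∃ B, B = b2 - q2 - m * (b1 - p1) := ⟨_, rfl⟩
  rw [← hG] at hz2
  rw [← hB] at gb
  have hGB : 0 < G - B := by linarith
  obtain ⟨r, hr⟩ : ∃ r, r = (-B)/(G-B) := ⟨_, rfl⟩
  have hr0 : 0 ≤ r := by rw [hr]; apply div_nonneg <;> linarith
  have hr1 : r ≤ 1 := by rw [hr, div_le_one hGB]; linarith
  have hr' : r * (G - B) = -B := by rw [hr]; field_simp
  obtain ⟨t, ht⟩ : ∃ t, t = r * t0 := ⟨_, rfl⟩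
  have t0' : 0 ≤ t := by rw [ht]; positivity
  have t1' : t ≤ 1 := by rw [ht]; exact mul_le_one₀ hr1 ht0 ht1
  obtain ⟨y1, hy1⟩ : ∃ y, y = t*a1+(1-t)*b1 := ⟨_, rfl⟩
  obtain ⟨y2, hy2⟩ : ∃ y, y = t*a2+(1-t)*b2 := ⟨_, rfl⟩
  have hyC : C y1 y2 := by rw [hy1, hy2]; exact hconv _ _ _ _ _ t0' t1' (hIC _ _ ha) hb
  have hyp : y1 ≤ p1 := by
    have : y1 = r * (t0*a1+(1-t0)*b1) + (1-r) * b1 := by rw [hy1, ht]; ring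
    rw [this]
    nlinarith
  have hyg : y2 = q2 + m * (y1 - p1) := by
    have : y2 - q2 - m * (y1 - p1) = r * G + (1-r) * B := by
      rw [hy1, hy2, ht, hG, hB]; ring
    linarith
  rcases le_or_gt e1 y1 with hey | hey
  · apply nl t ((y1 - e1)/(s1-e1)) t0' t1' (by apply div_nonneg <;> linarith)
      (by rw [div_le_one hes]; linarith)
    · rw [← hy1]; field_simp; ring
    · rw [← hy2, hyg, hs2, he2]; field_simp; ring
  · apply heI
    have hd : 0 < s1 - y1 := by linarith
    have := hint s1 s2 y1 y2 ((e1 - y1)/(s1-y1)) (by apply div_pos <;> linarith)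
      (by rw [div_le_one hd]; linarith) hsI hyC
    convert this using 1
    · field_simp; ring
    · rw [hyg, hs2, he2]; field_simp; ring

theorem Cfg.vert {C I : ℝ → ℝ → Prop} {p1 p2 lo hi q2 s1 s2 e1 e2 θ a1 a2 b1 b2 : ℝ}
    (h : Cfg C I p1 p2 lo hi q2 s1 s2 e1 e2 θ a1 a2 b1 b2)
    (hs : p1 = s1) (hq : p2 < q2) (hne : ¬ (p1 = e1 ∧ p2 = e2)) : False := by
  obtain ⟨hIC, hconv, hint, hlp, hph, hlq, hqh, hp, hpI, hsI, he, heI, hθ, hθ1, hq1, hq2,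
    ha, hb, hbI, hull, nb, nl⟩ := h
  have he1 : e1 = p1 := by
    have : θ * (e1 - s1) = 0 := by linarith
    rcases mul_eq_zero.1 this with h | h <;> linarith
  subst hs; subst he1
  have seg : ∀ y d, I e1 y → C e1 d → ∀ w, (y < w ∧ w < d) ∨ (d < w ∧ w < y) → I e1 w := by
    intro y d hy hd w hw
    have hne : y - d ≠ 0 := by rcases hw with h | h <;> intro h0 <;> linarith
    have := hint e1 y e1 d ((w - d)/(y-d))
      (by rcases hw with h | h
          · exact div_pos_of_neg_of_neg (by linarith) (by linarith)
          · apply div_pos <;> linarith)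
      (by rcases hw with h | h
          · rw [div_le_one_of_neg (by linarith)]; linarith
          · rw [div_le_one (by linarith)]; linarith) hy hd
    convert this using 1
    · ring
    · field_simp; ring
  have hqC : C e1 q2 := by
    have := hconv e1 e2 e1 s2 θ hθ.le hθ1 he (hIC _ _ hsI)
    convert this using 1
    · ring
    · rw [hq2]; ring
  have hsbox : s2 < lo ∨ hi < s2 := by
    by_contra hc
    push Not at hc
    exact hull 1 zero_le_one le_rfl (by ring) (by linarith) (by linarith)
  rcases hsbox with h | h
  · exact hpI (seg s2 q2 hsI hqC p2 (Or.inl ⟨by linarith, hq⟩))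
  · have heq : e2 ≤ q2 := by nlinarith
    rcases lt_trichotomy e2 p2 with h1 | h1 | h1
    · exact hpI (seg s2 e2 hsI he p2 (Or.inr ⟨h1, by linarith⟩))
    · exact hne ⟨rfl, h1.symm⟩
    · exact heI (seg s2 p2 hsI hp e2 (Or.inr ⟨h1, by linarith⟩))

theorem Cfg.flipX {C I : ℝ → ℝ → Prop} {p1 p2 lo hi q2 s1 s2 e1 e2 θ a1 a2 b1 b2 : ℝ}
    (h : Cfg C I p1 p2 lo hi q2 s1 s2 e1 e2 θ a1 a2 b1 b2) :
    Cfg (fun x y => C (-x) y) (fun x y => I (-x) y)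
      (-p1) p2 lo hi q2 (-s1) s2 (-e1) e2 θ (-a1) a2 (-b1) b2 := by
  obtain ⟨hIC, hconv, hint, hlp, hph, hlq, hqh, hp, hpI, hsI, he, heI, hθ, hθ1, hq1, hq2,
    ha, hb, hbI, hull, nb, nl⟩ := h
  refine ⟨fun x y => hIC _ _, ?_, ?_, hlp, hph, hlq, hqh, by simpa, by simpa, by simpa, by simpa,
    by simpa, hθ, hθ1, by linarith, hq2, by simpa, by simpa, by simpa, ?_, ?_, ?_⟩
  · intro a b c d t h0 h1 hh hh'
    have := hconv _ _ _ _ t h0 h1 hh hh'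
    convert this using 1; ring
  · intro a b c d t h0 h1 hh hh'
    have := hint _ _ _ _ t h0 h1 hh hh'
    convert this using 1; ring
  · intro t h0 h1 hh
    exact hull t h0 h1 (by linarith)
  · intro t h0 h1 hh
    exact nb t h0 h1 (by linarith)
  · intro t r h0 h1 h2 h3 hh
    exact nl t r h0 h1 h2 h3 (by linarith)

theorem Cfg.flipY {C I : ℝ → ℝ → Prop} {p1 p2 lo hi q2 s1 s2 e1 e2 θ a1 a2 b1 b2 : ℝ}
    (h : Cfg C I p1 p2 lo hi q2 s1 s2 e1 e2 θ a1 a2 b1 b2) :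
    Cfg (fun x y => C x (-y)) (fun x y => I x (-y))
      p1 (-p2) (-hi) (-lo) (-q2) s1 (-s2) e1 (-e2) θ a1 (-a2) b1 (-b2) := by
  obtain ⟨hIC, hconv, hint, hlp, hph, hlq, hqh, hp, hpI, hsI, he, heI, hθ, hθ1, hq1, hq2,
    ha, hb, hbI, hull, nb, nl⟩ := h
  refine ⟨fun x y => hIC _ _, ?_, ?_, by linarith, by linarith, by linarith, by linarith,
    by simpa, by simpa, by simpa, by simpa,
    by simpa, hθ, hθ1, by linarith, by linarith, by simpa, by simpa, by simpa, ?_, ?_, ?_⟩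
  · intro a b c d t h0 h1 hh hh'
    have := hconv _ _ _ _ t h0 h1 hh hh'
    convert this using 1; ring
  · intro a b c d t h0 h1 hh hh'
    have := hint _ _ _ _ t h0 h1 hh hh'
    convert this using 1; ring
  · intro t h0 h1 hh h2 h3
    exact hull t h0 h1 hh (by linarith) (by linarith)
  · intro t h0 h1 hh h2 h3
    exact nb t h0 h1 hh (by linarith) (by linarith)
  · intro t r h0 h1 h2 h3 hh h4
    exact nl t r h0 h1 h2 h3 hh (by linarith)

theorem twoNeg_rev {x y z x' y' z' : ℝ} (h : TwoNeg x y z) (hx : x = y') (hy : y = x')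
    (hz : z = z') : TwoNeg x' y' z' := by
  subst hx hy hz
  unfold TwoNeg at *; tauto

/-- All four sign cases together: `(a,b)` is the clockwise neighbour, `(c,d)` the other. -/
theorem Cfg.all {C I : ℝ → ℝ → Prop}
    {p1 p2 lo hi q2 s1 s2 e1 e2 θ a1 a2 b1 b2 c1 c2 d1 d2 : ℝ}
    (h : Cfg C I p1 p2 lo hi q2 s1 s2 e1 e2 θ a1 a2 b1 b2)
    (h' : Cfg C I p1 p2 lo hi q2 s1 s2 e1 e2 θ c1 c2 d1 d2)
    (hne : ¬ (p1 = e1 ∧ p2 = e2)) (hpq : p2 ≠ q2)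
    (hX : TwoNeg ((b1-p1)*(s2-p2)-(b2-p2)*(s1-p1)) ((e1-b1)*(s2-b2)-(e2-b2)*(s1-b1))
      ((p1-e1)*(s2-e2)-(p2-e2)*(s1-e1)))
    (hX' : TwoNeg ((d1-e1)*(s2-e2)-(d2-e2)*(s1-e1)) ((p1-d1)*(s2-d2)-(p2-d2)*(s1-d1))
      ((e1-p1)*(s2-p2)-(e2-p2)*(s1-p1))) : False := by
  rcases lt_or_gt_of_ne hpq with hq | hq <;> rcases lt_trichotomy p1 s1 with hs | hs | hs
  · exact h.core hs hq hX
  · exact h.vert hs hq hne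
  · exact h'.flipX.core (by linarith) hq (twoNeg_rev hX' (by ring) (by ring) (by ring))
  · exact h'.flipY.core hs (by linarith) (twoNeg_rev hX' (by ring) (by ring) (by ring))
  · exact h.flipY.vert hs (by linarith) (fun hh => hne ⟨hh.1, by linarith [hh.2]⟩)
  · refine h.flipX.flipY.core (by linarith) (by linarith) ?_
    have e : ∀ {x y z x' y' z' : ℝ}, TwoNeg x y z → x = x' → y = y' → z = z' →
      TwoNeg x' y' z' := by intro x y z x' y' z' h a b c; rwa [← a, ← b, ← c]
    exact e hX (by ring) (by ring) (by ring)

theorem right_ineq {C : Set Pt} (hC : Convex ℝ C) {r u v : Pt} (hr : r ∈ rightChain C)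
    (hu : u ∈ C) (hv : v ∈ C) (h1 : u.2 ≤ r.2) (h2 : r.2 ≤ v.2) (h3 : u.2 < v.2) :
    (v.1 - u.1) * (r.2 - u.2) ≤ (r.1 - u.1) * (v.2 - u.2) := by
  have hd : 0 < v.2 - u.2 := by linarith
  obtain ⟨t, ht⟩ : ∃ t, t = (r.2 - u.2)/(v.2-u.2) := ⟨_, rfl⟩
  have ht' : t * (v.2 - u.2) = r.2 - u.2 := by rw [ht]; field_simp
  have h0 : 0 ≤ t := by rw [ht]; apply div_nonneg <;> linarith
  have h1' : t ≤ 1 := by rw [ht, div_le_one hd]; linarith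
  have := hr.2.2 _ (hC hu hv (by linarith : 0 ≤ 1 - t) h0 (by ring)) (by simp; linarith)
  simp at this
  rw [← ht']
  have h4 : 0 ≤ (r.1 - u.1) - t * (v.1 - u.1) := by linarith
  have := mul_nonneg h4 hd.le
  linarith

theorem left_ineq {C : Set Pt} (hC : Convex ℝ C) {r u v : Pt} (hr : r ∈ leftChain C)
    (hu : u ∈ C) (hv : v ∈ C) (h1 : u.2 ≤ r.2) (h2 : r.2 ≤ v.2) (h3 : u.2 < v.2) :
    (r.1 - u.1) * (v.2 - u.2) ≤ (v.1 - u.1) * (r.2 - u.2) := by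
  have hd : 0 < v.2 - u.2 := by linarith
  obtain ⟨t, ht⟩ : ∃ t, t = (r.2 - u.2)/(v.2-u.2) := ⟨_, rfl⟩
  have ht' : t * (v.2 - u.2) = r.2 - u.2 := by rw [ht]; field_simp
  have h0 : 0 ≤ t := by rw [ht]; apply div_nonneg <;> linarith
  have h1' : t ≤ 1 := by rw [ht, div_le_one hd]; linarith
  have := hr.2.2 _ (hC hu hv (by linarith : 0 ≤ 1 - t) h0 (by ring)) (by simp; linarith)
  simp at this
  rw [← ht']
  have h4 : 0 ≤ t * (v.1 - u.1) - (r.1 - u.1) := by linarith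
  have := mul_nonneg h4 hd.le
  linarith

theorem exists_eps {C : Set Pt} {o : Pt} (ho : o ∈ interior C) :
    ∃ ε : ℝ, 0 < ε ∧ (o.1 + ε, o.2) ∈ C ∧ (o.1 - ε, o.2) ∈ C := by
  obtain ⟨r, hr, hb⟩ := Metric.isOpen_iff.1 isOpen_interior o ho
  refine ⟨r/2, by linarith, interior_subset (hb ?_), interior_subset (hb ?_)⟩
  · rw [Metric.mem_ball, Prod.dist_eq]
    simp [abs_of_pos hr, hr]
  · rw [Metric.mem_ball, Prod.dist_eq]
    simp [Real.dist_eq, abs_of_pos hr, hr]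


theorem rr_top {C : Set Pt} (hC : Convex ℝ C) {o : Pt} (ho : o ∈ interior C)
    {a b : Pt} (ha : a ∈ rightChain C) (hb : b ∈ rightChain C)
    (h : b.2 < a.2) (h' : o.2 ≤ b.2) : cross2 a b o < 0 := by
  obtain ⟨ε, hε, h1, h2⟩ := exists_eps ho
  have := right_ineq hC hb h1 ha.1 h' h.le (show o.2 < a.2 by linarith)
  simp only at this
  have := mul_pos hε (sub_pos.2 h)
  unfold cross2; linarith

theorem rr_bot {C : Set Pt} (hC : Convex ℝ C) {o : Pt} (ho : o ∈ interior C)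
    {a b : Pt} (ha : a ∈ rightChain C) (hb : b ∈ rightChain C)
    (h : b.2 < a.2) (h' : a.2 ≤ o.2) : cross2 a b o < 0 := by
  obtain ⟨ε, hε, h1, h2⟩ := exists_eps ho
  have := right_ineq hC ha hb.1 h1 h.le h' (show b.2 < o.2 by linarith)
  simp only at this
  have := mul_pos hε (sub_pos.2 h)
  unfold cross2; linarith

theorem ll_top {C : Set Pt} (hC : Convex ℝ C) {o : Pt} (ho : o ∈ interior C)
    {a b : Pt} (ha : a ∈ leftChain C) (hb : b ∈ leftChain C)
    (h : a.2 < b.2) (h' : o.2 ≤ a.2) : cross2 a b o < 0 := by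
  obtain ⟨ε, hε, h1, h2⟩ := exists_eps ho
  have := left_ineq hC ha h2 hb.1 h' h.le (show o.2 < b.2 by linarith)
  simp only at this
  have := mul_pos hε (sub_pos.2 h)
  unfold cross2; linarith

theorem ll_bot {C : Set Pt} (hC : Convex ℝ C) {o : Pt} (ho : o ∈ interior C)
    {a b : Pt} (ha : a ∈ leftChain C) (hb : b ∈ leftChain C)
    (h : a.2 < b.2) (h' : b.2 ≤ o.2) : cross2 a b o < 0 := by
  obtain ⟨ε, hε, h1, h2⟩ := exists_eps ho
  have := left_ineq hC hb ha.1 h2 h.le h' (show a.2 < o.2 by linarith)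
  simp only at this
  have := mul_pos hε (sub_pos.2 h)
  unfold cross2; linarith

/-- left top point `c`, right top point `a`. -/
theorem lr_top {C : Set Pt} (hC : Convex ℝ C) {o : Pt} (ho : o ∈ interior C)
    {c a : Pt} (hc : c ∈ leftChain C) (ha : a ∈ rightChain C)
    (hne : c ∉ rightChain C) (h1 : o.2 ≤ c.2) (h2 : o.2 ≤ a.2) (h3 : o.2 < c.2 ∨ o.2 < a.2) :
    cross2 c a o < 0 := by
  obtain ⟨ε, hε, e1, e2⟩ := exists_eps ho
  rcases lt_trichotomy c.2 a.2 with h | h | h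
  · have := left_ineq hC hc e2 ha.1 h1 h.le (show o.2 < a.2 by linarith)
    simp only at this
    have := mul_pos hε (sub_pos.2 h)
    unfold cross2; linarith
  · have hle := hc.2.2 a ha.1 h.symm
    have hlt : c.1 < a.1 := lt_of_le_of_ne hle (fun he => hne (by
      have : c = a := Prod.ext he h
      rw [this]; exact ha))
    have h4 : o.2 < c.2 := by rcases h3 with h3 | h3 <;> linarith
    have := mul_pos (sub_pos.2 hlt) (sub_pos.2 h4)
    unfold cross2; rw [← h]; linarith
  · have := right_ineq hC ha e1 hc.1 h2 h.le (show o.2 < c.2 by linarith)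
    simp only at this
    have := mul_pos hε (sub_pos.2 h)
    unfold cross2; linarith

theorem rl_bot {C : Set Pt} (hC : Convex ℝ C) {o : Pt} (ho : o ∈ interior C)
    {b c : Pt} (hb : b ∈ rightChain C) (hc : c ∈ leftChain C)
    (hne : c ∉ rightChain C) (h1 : c.2 < o.2) (h2 : b.2 < o.2) :
    cross2 b c o < 0 := by
  obtain ⟨ε, hε, e1, e2⟩ := exists_eps ho
  rcases lt_trichotomy c.2 b.2 with h | h | h
  · have := right_ineq hC hb hc.1 e1 h.le h2.le (show c.2 < o.2 by linarith)
    simp only at this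
    have := mul_pos hε (sub_pos.2 h)
    unfold cross2; linarith
  · have hle := hc.2.2 b hb.1 h.symm
    have hlt : c.1 < b.1 := lt_of_le_of_ne hle (fun he => hne (by
      have : c = b := Prod.ext he h
      rw [this]; exact hb))
    have := mul_pos (sub_pos.2 hlt) (sub_pos.2 h1)
    unfold cross2; rw [← h]; linarith
  · have := left_ineq hC hc hb.1 e2 h.le h1.le (show b.2 < o.2 by linarith)
    simp only at this
    have := mul_pos hε (sub_pos.2 h)
    unfold cross2; linarith

theorem cross_id (a b c o : Pt) :
    cross2 b c o * (a.2 - o.2) + cross2 c a o * (b.2 - o.2) + cross2 a b o * (c.2 - o.2) = 0 := by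
  unfold cross2; ring

theorem tn_rot {x y z : ℝ} (h : TwoNeg x y z) : TwoNeg y z x := by
  unfold TwoNeg at *; tauto

theorem tn_topbot {u v w o : Pt} (hw : w ≠ o) (h : cross2 u v o < 0)
    (hs : (o.2 ≤ u.2 ∧ o.2 ≤ v.2 ∧ w.2 < o.2) ∨ (u.2 < o.2 ∧ v.2 < o.2 ∧ o.2 ≤ w.2)) :
    TwoNeg (cross2 u v o) (cross2 v w o) (cross2 w u o) := by
  by_cases h1 : cross2 v w o < 0
  · exact Or.inl ⟨h, h1⟩
  by_cases h2 : cross2 w u o < 0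
  · exact Or.inr (Or.inr ⟨h, h2⟩)
  exfalso
  push Not at h1 h2
  have hid := cross_id u v w o
  rcases hs with ⟨a, b, c⟩ | ⟨a, b, c⟩
  · have := mul_nonneg h1 (sub_nonneg.2 a)
    have := mul_nonneg h2 (sub_nonneg.2 b)
    have := mul_pos_of_neg_of_neg h (sub_neg.2 c)
    linarith
  · have e1 := mul_nonneg h1 (sub_nonneg.2 a.le)
    have e2 := mul_nonneg h2 (sub_nonneg.2 b.le)
    have e3 := mul_nonneg (neg_nonneg.2 h.le) (sub_nonneg.2 c)
    have f1 : cross2 v w o = 0 := by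
      rcases h1.eq_or_lt with h1 | h1
      · exact h1.symm
      · have := mul_pos h1 (sub_pos.2 a); linarith
    have f2 : cross2 w u o = 0 := by
      rcases h2.eq_or_lt with h2 | h2
      · exact h2.symm
      · have := mul_pos h2 (sub_pos.2 b); linarith
    have f3 : w.2 = o.2 := by
      rcases c.eq_or_lt with c | c
      · exact c.symm
      · have := mul_pos (neg_pos.2 h) (sub_pos.2 c); linarith
    have g1 : w.1 = o.1 := by
      unfold cross2 at f1
      rw [f3] at f1
      have : (o.2 - v.2) * (w.1 - o.1) = 0 := by linarith
      rcases mul_eq_zero.1 this with h | h <;> linarith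
    exact hw (Prod.ext g1 f3)

theorem cw_frontier {C : Set Pt} {a b : Pt} (h : CwLT C a b) :
    a ∈ frontier C ∧ b ∈ frontier C := by
  rcases h with h | h | h
  · exact ⟨h.1.2.1, h.2.1.2.1⟩
  · exact ⟨h.1.2.1, h.2.1.2.1⟩
  · exact ⟨h.2.1.2.1, h.2.2.1.2.1⟩

theorem cw_trans_s9 {C : Set Pt} {a b c : Pt} (hab : CwLT C a b) (hbc : CwLT C b c) :
    CwLT C a c := by
  unfold CwLT at *
  rcases hab with h | h | h <;> rcases hbc with k | k | k
  · exact Or.inl ⟨h.1, k.2.1, k.2.2.trans h.2.2⟩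
  · exact Or.inr (Or.inl ⟨h.1, k.2⟩)
  · exact absurd h.2.1 k.1
  · exact absurd k.1 h.2.2
  · exact absurd k.1 h.2.2
  · exact Or.inr (Or.inl ⟨h.1, k.2.2.1, k.2.2.2.1⟩)
  · exact absurd k.1 h.2.2.2.1
  · exact absurd k.1 h.2.2.2.1
  · exact Or.inr (Or.inr ⟨h.1, h.2.1, k.2.2.1, k.2.2.2.1, h.2.2.2.2.trans k.2.2.2.2⟩)

theorem cw_bot {C : Set Pt} (hC : Convex ℝ C) {o : Pt} (ho : o ∈ interior C)
    {a b : Pt} (h : CwLT C a b) (h1 : a.2 < o.2) (h2 : b.2 < o.2) : cross2 a b o < 0 := by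
  rcases h with h | h | h
  · exact rr_bot hC ho h.1 h.2.1 h.2.2 h1.le
  · exact rl_bot hC ho h.1 h.2.1 h.2.2 h2 h1
  · exact ll_bot hC ho h.2.1 h.2.2.1 h.2.2.2.2 h2.le

theorem twoNeg_of_cw {C : Set Pt} (hC : Convex ℝ C) {o : Pt} (ho : o ∈ interior C)
    {a b c : Pt} (hab : CwLT C a b) (hbc : CwLT C b c) :
    TwoNeg (cross2 a b o) (cross2 b c o) (cross2 c a o) := by
  have hne : ∀ w, w ∈ frontier C → w ≠ o := by
    intro w hw he
    rw [he] at hw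
    exact hw.2 ho
  have ha := hne a (cw_frontier hab).1
  have hb := hne b (cw_frontier hab).2
  have hc := hne c (cw_frontier hbc).2
  have hac := cw_trans_s9 hab hbc
  rcases lt_or_ge a.2 o.2 with a0 | a0 <;> rcases lt_or_ge b.2 o.2 with b0 | b0 <;>
    rcases lt_or_ge c.2 o.2 with c0 | c0
  · exact Or.inl ⟨cw_bot hC ho hab a0 b0, cw_bot hC ho hbc b0 c0⟩
  · exact tn_topbot hc (cw_bot hC ho hab a0 b0) (Or.inr ⟨a0, b0, c0⟩)
  · -- a, c bottom, b top: impossible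
    exfalso
    rcases hab with h | h | h
    · linarith [h.2.2]
    · rcases hbc with k | k | k
      · exact h.2.2 k.1
      · exact h.2.2 k.1
      · linarith [k.2.2.2.2]
    · rcases hbc with k | k | k
      · exact h.2.2.2.1 k.1
      · exact h.2.2.2.1 k.1
      · linarith [k.2.2.2.2]
  · -- a bottom
    have hX : cross2 b c o < 0 := by
      rcases hbc with k | k | k
      · exact rr_top hC ho k.1 k.2.1 k.2.2 c0
      · rcases hab with h | h | h
        · linarith [h.2.2]
        · exact absurd k.1 h.2.2
        · exact absurd k.1 h.2.2.2.1
      · exact ll_top hC ho k.2.1 k.2.2.1 k.2.2.2.2 b0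
    exact tn_rot (tn_rot (tn_topbot ha hX (Or.inl ⟨b0, c0, a0⟩)))
  · exact tn_rot (tn_topbot ha (cw_bot hC ho hbc b0 c0) (Or.inr ⟨b0, c0, a0⟩)) |> tn_rot
  · -- b bottom
    rcases hac with k | k | k
    · exfalso
      rcases hbc with h | h | h
      · linarith [h.2.2]
      · exact h.2.2 k.2.1
      · exact h.2.2.2.1 k.2.1
    · by_cases hz : o.2 < c.2 ∨ o.2 < a.2
      · have hX := lr_top hC ho k.2.1 k.1 k.2.2 c0 a0 hz
        exact tn_rot (tn_topbot hb hX (Or.inl ⟨c0, a0, b0⟩))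
      · push Not at hz
        have hc2 : c.2 = o.2 := le_antisymm hz.1 c0
        have ha2 : a.2 = o.2 := le_antisymm hz.2 a0
        obtain ⟨ε, hε, e1, e2⟩ := exists_eps ho
        have h1 := k.1.2.2 _ e1 ha2.symm
        have h2 := k.2.1.2.2 _ e2 hc2.symm
        simp only at h1 h2
        left
        unfold cross2
        rw [ha2, hc2]
        constructor
        · have : 0 < (o.2 - b.2) * (a.1 - o.1) := mul_pos (by linarith) (by linarith)
          linarith
        · have : 0 < (o.2 - b.2) * (o.1 - c.1) := mul_pos (by linarith) (by linarith)
          linarith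
    · exfalso
      rcases hab with h | h | h
      · exact k.1 h.1
      · exact k.1 h.1
      · linarith [h.2.2.2.2]
  · -- c bottom
    have hX : cross2 a b o < 0 := by
      rcases hab with k | k | k
      · exact rr_top hC ho k.1 k.2.1 k.2.2 b0
      · rcases hbc with h | h | h
        · exact absurd h.1 k.2.2
        · exact absurd h.1 k.2.2
        · linarith [h.2.2.2.2]
      · exact ll_top hC ho k.2.1 k.2.2.1 k.2.2.2.2 a0
    exact tn_topbot hc hX (Or.inl ⟨a0, b0, c0⟩)
  · rcases hab with h | h | h <;> rcases hbc with k | k | k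
    · exact Or.inl ⟨rr_top hC ho h.1 h.2.1 h.2.2 b0, rr_top hC ho k.1 k.2.1 k.2.2 c0⟩
    · exact Or.inr (Or.inr ⟨rr_top hC ho h.1 h.2.1 h.2.2 b0,
        lr_top hC ho k.2.1 h.1 k.2.2 c0 a0 (Or.inr (by linarith [h.2.2]))⟩)
    · exact absurd h.2.1 k.1
    · exact absurd k.1 h.2.2
    · exact absurd k.1 h.2.2
    · exact Or.inr (Or.inl ⟨ll_top hC ho k.2.1 k.2.2.1 k.2.2.2.2 b0,
        lr_top hC ho k.2.2.1 h.1 k.2.2.2.1 c0 a0 (Or.inl (by linarith [k.2.2.2.2]))⟩)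
    · exact absurd k.1 h.2.2.2.1
    · exact absurd k.1 h.2.2.2.1
    · exact Or.inl ⟨ll_top hC ho h.2.1 h.2.2.1 h.2.2.2.2 a0,
        ll_top hC ho k.2.1 k.2.2.1 k.2.2.2.2 b0⟩

def CycP (C : Set Pt) (a b c : Pt) : Prop :=
  ∀ o ∈ interior C, TwoNeg (cross2 a b o) (cross2 b c o) (cross2 c a o)

theorem CycP.rot {C : Set Pt} {a b c : Pt} (h : CycP C a b c) : CycP C b c a :=
  fun o ho => tn_rot (h o ho)

theorem CycP.of {C : Set Pt} (hC : Convex ℝ C) {a b c : Pt} (hab : CwLT C a b)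
    (hbc : CwLT C b c) : CycP C a b c := fun _ ho => twoNeg_of_cw hC ho hab hbc

/-- neighbours in the cyclic order -/
theorem exists_nbrs {C : Set Pt} (hC : Convex ℝ C) {L : List Label} (hr : InRadialOrder C L)
    (hnd : (L.map Label.site).Nodup) {x y : Label} (hx : x ∈ L) (hy : y ∈ L) (hxy : x ≠ y)
    (hcon : ¬ Consecutive L x y) :
    ∃ a ∈ L, ∃ c ∈ L, Consecutive L x a ∧ Consecutive L x c ∧ a ≠ x ∧ a ≠ y ∧ c ≠ x ∧ c ≠ y ∧
      CycP C x.port a.port y.port ∧ CycP C y.port c.port x.port := by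
  have hp : L.Pairwise (fun a b => CwLT C a.port b.port) := by
    have : IsTrans Label (fun a b => CwLT C a.port b.port) := ⟨fun _ _ _ => cw_trans_s9⟩
    exact List.isChain_iff_pairwise.1 hr
  have hcw : ∀ i j (hi : i < L.length) (hj : j < L.length), i < j →
      CwLT C L[i].port L[j].port := fun i j hi hj hij => List.pairwise_iff_getElem.1 hp i j hi hj hij
  have hnd' : L.Nodup := List.Nodup.of_map _ hnd
  have hinj : ∀ i j (hi : i < L.length) (hj : j < L.length), i ≠ j → L[i] ≠ L[j] :=
    fun i j hi hj hij he => hij ((List.Nodup.getElem_inj_iff hnd').1 he)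
  have hcs : ∀ i j (hi : i < L.length) (hj : j < L.length), j = (i+1) % L.length →
      (L[i], L[j]) ∈ L.zip (L.rotate 1) := by
    intro i j hi hj hij
    rw [List.mem_iff_getElem]
    refine ⟨i, by simpa using hi, ?_⟩
    subst hij
    simp [List.getElem_rotate]
  obtain ⟨i, hi, rfl⟩ := List.mem_iff_getElem.1 hx
  obtain ⟨j, hj, rfl⟩ := List.mem_iff_getElem.1 hy
  have hij : i ≠ j := by rintro rfl; exact hxy rfl
  have hn1 : j ≠ (i+1) % L.length := fun h => hcon (Or.inl (hcs i j hi hj h))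
  have hn2 : i ≠ (j+1) % L.length := fun h => hcon (Or.inr (hcs j i hj hi h))
  obtain ⟨k, hk, hkl⟩ : ∃ k, k = (i+1) % L.length ∧ k < L.length :=
    ⟨_, rfl, Nat.mod_lt _ (by omega)⟩
  obtain ⟨m, hm, hml⟩ : ∃ m, i = (m+1) % L.length ∧ m < L.length := by
    rcases Nat.eq_zero_or_pos i with h | h
    · refine ⟨L.length - 1, ?_, by omega⟩
      rw [Nat.sub_add_cancel (by omega)]; simp [h]
    · refine ⟨i - 1, ?_, by omega⟩
      rw [Nat.sub_add_cancel h, Nat.mod_eq_of_lt hi]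
  have hkv : (i + 1 < L.length ∧ k = i + 1) ∨ (i + 1 = L.length ∧ k = 0) := by
    rcases Nat.lt_or_ge (i+1) L.length with h | h
    · left; exact ⟨h, by rw [hk, Nat.mod_eq_of_lt h]⟩
    · right
      have : i + 1 = L.length := by omega
      exact ⟨this, by rw [hk, this, Nat.mod_self]⟩
  have hmv : (m + 1 < L.length ∧ i = m + 1) ∨ (m + 1 = L.length ∧ i = 0) := by
    rcases Nat.lt_or_ge (m+1) L.length with h | h
    · left; exact ⟨h, by rw [hm, Nat.mod_eq_of_lt h]⟩
    · right
      have : m + 1 = L.length := by omega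
      exact ⟨this, by rw [hm, this, Nat.mod_self]⟩
  have hmj : m ≠ j := by
    rintro rfl; exact hn2 hm
  have hkj : k ≠ j := fun h => hn1 (by rw [← h, hk])
  have cyc : ∀ u v w (hu : u < L.length) (hv : v < L.length) (hw : w < L.length),
      (u < v ∧ v < w) ∨ (v < w ∧ w < u) ∨ (w < u ∧ u < v) →
      CycP C L[u].port L[v].port L[w].port := by
    intro u v w hu hv hw h
    rcases h with h | h | h
    · exact CycP.of hC (hcw _ _ _ _ h.1) (hcw _ _ _ _ h.2)
    · exact (CycP.of hC (hcw _ _ hv hw h.1) (hcw _ _ _ hu h.2)).rot.rot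
    · exact (CycP.of hC (hcw _ _ hw hu h.1) (hcw _ _ _ hv h.2)).rot
  refine ⟨L[k], List.getElem_mem _, L[m], List.getElem_mem _, Or.inl (hcs _ _ _ _ hk),
    Or.inr (hcs _ _ _ _ hm), hinj _ _ _ _ ?_, hinj _ _ _ _ hkj, hinj _ _ _ _ ?_,
    hinj _ _ _ _ hmj, cyc _ _ _ _ _ _ ?_, cyc _ _ _ _ _ _ ?_⟩ <;> omega

theorem leaders_disj {L : List Label} (hl : LeadersDisjoint L) {a b : Label} (ha : a ∈ L)
    (hb : b ∈ L) (hab : a ≠ b) : a.leader ∩ b.leader = ∅ := by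
  have : Std.Symm (fun a b : Label => a.leader ∩ b.leader = ∅) :=
    ⟨fun u v h => by rw [Set.inter_comm]; exact h⟩
  exact List.Pairwise.forall hl ha hb hab

theorem mem_seg {a b : Pt} {t : ℝ} (h0 : 0 ≤ t) (h1 : t ≤ 1) :
    ((t*a.1+(1-t)*b.1, t*a.2+(1-t)*b.2) : Pt) ∈ segment ℝ a b :=
  ⟨t, 1-t, h0, by linarith, by ring, by ext <;> simp⟩

theorem mk_cfg {C : Set Pt} {S : Finset Pt} {L : List Label}
    (hC : IsContour C) (hSin : ∀ s ∈ S, s ∈ interior C)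
    (hlab : IsContourLabeling C S L)
    (hassum : Assumption1 S L)
    (hleaders : LeadersDisjoint L)
    (hcons : ConsecutiveDisjoint L)
    {x y a : Label} (hx : x ∈ L) (hy : y ∈ L) (ha : a ∈ L)
    (hpx : x.port.1 ∈ Set.Icc x.lo.1 x.hi.1) (hpx2 : x.port.2 ∈ Set.Icc x.lo.2 x.hi.2)
    (hca : Consecutive L x a) (hax : a ≠ x) (hay : a ≠ y)
    {q2 θ : ℝ} (hq : q2 ∈ Set.Icc x.lo.2 x.hi.2) (hθ : 0 < θ) (hθ1 : θ ≤ 1)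
    (hq1 : x.port.1 = y.site.1 + θ * (y.port.1 - y.site.1))
    (hq2 : q2 = y.site.2 + θ * (y.port.2 - y.site.2)) :
    Cfg (fun u v => (u, v) ∈ C) (fun u v => (u, v) ∈ interior C)
      x.port.1 x.port.2 x.lo.2 x.hi.2 q2 y.site.1 y.site.2 y.port.1 y.port.2 θ
      a.site.1 a.site.2 a.port.1 a.port.2 := by
  have hcl : IsClosed C := hC.compact.isClosed
  have hfr : ∀ z ∈ L, z.port ∈ C ∧ z.port ∉ interior C := by
    intro z hz
    have := (hlab.valid z hz).port_bd
    exact ⟨hcl.frontier_subset this, this.2⟩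
  have hsite : ∀ z ∈ L, z.site ∈ S := fun z hz =>
    (hlab.sites_iff _).2 (List.mem_map_of_mem hz)
  have hbox : ∀ v, x.lo.2 ≤ v → v ≤ x.hi.2 → (x.port.1, v) ∈ x.box :=
    fun v h1 h2 => ⟨⟨hpx.1, h1⟩, ⟨hpx.2, h2⟩⟩
  refine ⟨fun u v h => interior_subset h, ?_, ?_, hpx2.1, hpx2.2, hq.1, hq.2, (hfr x hx).1,
    (hfr x hx).2, hSin _ (hsite y hy), (hfr y hy).1, (hfr y hy).2, hθ, hθ1, hq1, hq2,
    hSin _ (hsite a ha), (hfr a ha).1, (hfr a ha).2, ?_, ?_, ?_⟩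
  · intro b c d e t h0 h1 hb hd
    exact hC.convex.segment_subset hb hd (mem_seg (a := (b, c)) (b := (d, e)) h0 h1)
  · intro b c d e t h0 h1 hb hd
    have := hC.convex.combo_interior_self_mem_interior hb hd h0 (by linarith : 0 ≤ 1 - t) (by ring)
    simpa using this
  · intro t h0 h1 e1 e2 e3
    have h := hassum x hx
    have hm : (x.port.1, t*y.site.2+(1-t)*a.site.2) ∈ x.box ∩ convexHull ℝ (S : Set Pt) := by
      refine ⟨hbox _ e2 e3, ?_⟩
      rw [← e1]
      exact (convex_convexHull ℝ _).segment_subset (subset_convexHull ℝ _ (hsite y hy))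
        (subset_convexHull ℝ _ (hsite a ha)) (mem_seg h0 h1)
    rw [h] at hm
    exact hm
  · intro t h0 h1 e1 e2 e3
    have h := hcons x a hca hax.symm
    have hm : (x.port.1, t*a.site.2+(1-t)*a.port.2) ∈ x.toSet ∩ a.toSet := by
      refine ⟨Or.inl (hbox _ e2 e3), Or.inr ?_⟩
      rw [← e1]
      exact mem_seg h0 h1
    rw [h] at hm
    exact hm
  · intro t r h0 h1 h2 h3 e1 e2
    have h : a.leader ∩ y.leader = ∅ :=
      leaders_disj hleaders ha hy hay
    have hm : (t*a.site.1+(1-t)*a.port.1, t*a.site.2+(1-t)*a.port.2) ∈ a.leader ∩ y.leader := by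
      refine ⟨mem_seg h0 h1, ?_⟩
      rw [e1, e2]
      exact mem_seg h2 h3
    rw [h] at hm
    exact hm

/-- Under the hypotheses of Lemma 1, the leader of a label is
disjoint from the text box of any non-consecutive label. -/
theorem statement_9
    (C : Set Pt) (t : Pt) (S : Finset Pt) (L : List Label)
    (hC : IsContour C) (ht : IsTopmost C t)
    (hSin : ∀ s ∈ S, s ∈ interior C) (hgen : GenPos S)
    (hlab : IsContourLabeling C S L)
    (hchains : PortsOnChains C L)
    (hstair : IsStaircase L)
    (hassum : Assumption1 S L)
    (hleaders : LeadersDisjoint L)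
    (hcons : ConsecutiveDisjoint L) :
    ∀ ℓ ∈ L, ∀ ℓ' ∈ L, ℓ ≠ ℓ' → ¬ Consecutive L ℓ ℓ' →
      Label.leader ℓ' ∩ Label.box ℓ = ∅ := by
  intro x hx y hy hxy hncon
  rw [Set.eq_empty_iff_forall_notMem]
  rintro q ⟨hql, hqb⟩
  have hvx := hlab.valid x hx
  have hvy := hlab.valid y hy
  have hdis : y.leader ∩ x.leader = ∅ :=
    leaders_disj hleaders hy hx hxy.symm
  have hqC : q ∈ C := hvy.leader_in hql
  have hpC : x.port ∈ C := hC.compact.isClosed.frontier_subset hvx.port_bd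
  have hpl : x.port ∈ x.leader := right_mem_segment ℝ _ _
  have hqp : q ≠ x.port := by
    intro h
    have : q ∈ y.leader ∩ x.leader := ⟨hql, by rw [h]; exact hpl⟩
    rw [hdis] at this; exact this
  have hpe : y.port ≠ x.port := by
    intro h
    have : y.port ∈ y.leader ∩ x.leader :=
      ⟨right_mem_segment ℝ _ _, by rw [h]; exact hpl⟩
    rw [hdis] at this; exact this
  have hlh := hvx.lo_le_hi
  have hp2 : x.port.2 ∈ Set.Icc x.lo.2 x.hi.2 := by
    cases h : x.isLeft
    · exact (hvx.right_ok h).2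
    · exact (hvx.left_ok h).2
  have hp1 : x.port.1 ∈ Set.Icc x.lo.1 x.hi.1 := by
    cases h : x.isLeft
    · rw [(hvx.right_ok h).1]; exact ⟨le_rfl, hlh.1⟩
    · rw [(hvx.left_ok h).1]; exact ⟨hlh.1, le_rfl⟩
  have hq1 : q.1 = x.port.1 := by
    by_contra hne
    by_cases h2 : q.2 = x.port.2
    · cases h : x.isLeft
      · have h3 := ((hchains x hx).2 h).2.2 q hqC h2
        have h4 := hqb.1.1
        rw [← (hvx.right_ok h).1] at h4
        exact hne (le_antisymm h3 h4)
      · have h3 := ((hchains x hx).1 h).2.2 q hqC h2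
        have h4 := hqb.2.1
        rw [← (hvx.left_ok h).1] at h4
        exact hne (le_antisymm h4 h3)
    · have hb := hvx.box_out
      have hm : ((1/2*q.1+(1-1/2)*x.port.1, 1/2*q.2+(1-1/2)*x.port.2) : Pt) ∈
          interior x.box ∩ C := by
        refine ⟨?_, hC.convex.segment_subset hqC hpC (mem_seg (by norm_num) (by norm_num))⟩
        unfold Label.box
        rw [Set.Icc_prod_eq, interior_prod_eq, interior_Icc, interior_Icc]
        have a1 := hqb.1.1
        have a2 := hqb.1.2
        have a3 := hqb.2.1
        have a4 := hqb.2.2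
        obtain ⟨b1, b2⟩ := hp1
        obtain ⟨b3, b4⟩ := hp2
        constructor
        · rcases lt_or_gt_of_ne hne with h | h <;> constructor <;> simp only <;> linarith
        · rcases lt_or_gt_of_ne h2 with h | h <;> constructor <;> simp only <;> linarith
      rw [hb] at hm
      exact hm
  have hq2b : q.2 ∈ Set.Icc x.lo.2 x.hi.2 := ⟨hqb.1.2, hqb.2.2⟩
  have hysite : y.site ∈ S := (hlab.sites_iff _).2 (List.mem_map_of_mem hy)
  obtain ⟨u, θ, hu, hθ, huθ, hqe⟩ := id hql
  have hu' : u = 1 - θ := by linarith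
  subst hu'
  have hθ0 : 0 < θ := by
    rcases hθ.eq_or_lt with h | h
    · exfalso
      have : q = y.site := by rw [← hqe, ← h]; simp
      have hm : q ∈ x.box ∩ convexHull ℝ (S : Set Pt) :=
        ⟨hqb, by rw [this]; exact subset_convexHull ℝ _ hysite⟩
      rw [hassum x hx] at hm
      exact hm
    · exact h
  have e1 : x.port.1 = y.site.1 + θ * (y.port.1 - y.site.1) := by
    rw [← hq1, ← hqe]; simp; ring
  have e2 : q.2 = y.site.2 + θ * (y.port.2 - y.site.2) := by
    rw [← hqe]; simp; ring
  obtain ⟨a, haL, c, hcL, hca, hcc, hax, hay, hcx, hcy, hP, hP'⟩ :=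
    exists_nbrs hC.convex hlab.radial hlab.nodup_sites hx hy hxy hncon
  have A := mk_cfg hC hSin hlab hassum hleaders hcons hx hy haL hp1 hp2 hca hax hay hq2b hθ0
    (by linarith) e1 e2
  have B := mk_cfg hC hSin hlab hassum hleaders hcons hx hy hcL hp1 hp2 hcc hcx hcy hq2b hθ0
    (by linarith) e1 e2
  exact A.all B (fun h => hpe (Prod.ext h.1.symm h.2.symm))
    (fun h => hqp (Prod.ext hq1 h.symm)) (hP _ (hSin _ hysite)) (hP' _ (hSin _ hysite))
end

section
/- Let s_1 and s_2 be distinct points of ℝ² and let P be a finite nonempty set of points all contained in one open half-plane bounded by the line through s_1 and s_2. Then there exists a point s ∈ P such that the interior of the triangle with vertices s_1, s, s_2 (the interior of the convex hull of {s_1, s, s_2}) contains no point of P. -/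
open scoped Classical
theorem aux_tri (s1 s2 : Pt) (hne : s1 ≠ s2) (P : Finset Pt) (hP : P.Nonempty) (c : ℝ)
    (hc : c * c = 1) (h : ∀ p ∈ P, 0 < c * cross2 s1 s2 p) :
    ∃ s ∈ P, ∀ p ∈ P, p ∉ interior (convexHull ℝ ({s1, s, s2} : Set Pt)) := by
  obtain ⟨s, hs, hmin⟩ := P.exists_min_image (fun p => c * cross2 s1 s2 p) hP
  refine ⟨s, hs, fun p hp hint => ?_⟩
  have hsub : convexHull ℝ ({s1, s, s2} : Set Pt)
      ⊆ {q | c * cross2 s1 s2 q ≤ c * cross2 s1 s2 s} := by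
    apply convexHull_min
    · have h0 := h s hs
      rintro q (rfl | rfl | rfl)
      · have : cross2 q s2 q = 0 := by unfold cross2; ring
        simp only [Set.mem_setOf_eq, this]; linarith
      · simp
      · have : cross2 s1 q q = 0 := by unfold cross2; ring
        simp only [Set.mem_setOf_eq, this]; linarith
    · intro x hx y hy a b ha hb hab
      simp only [Set.mem_setOf_eq] at *
      have e : c * cross2 s1 s2 (a • x + b • y)
          = a * (c * cross2 s1 s2 x) + b * (c * cross2 s1 s2 y) := by
        obtain rfl : b = 1 - a := by linarith
        simp only [cross2, Prod.fst_add, Prod.snd_add, Prod.smul_fst, Prod.smul_snd, smul_eq_mul]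
        ring
      rw [e]
      calc _ ≤ a * (c * cross2 s1 s2 s) + b * (c * cross2 s1 s2 s) := by gcongr
        _ = c * cross2 s1 s2 s := by rw [← add_mul, hab, one_mul]
  let v : Pt := (-(c * (s2.2 - s1.2)), c * (s2.1 - s1.1))
  have hcont : Continuous (fun t : ℝ => p + t • v) := by fun_prop
  have hnhds : ∀ᶠ t in nhds (0 : ℝ), p + t • v ∈ interior (convexHull ℝ ({s1, s, s2} : Set Pt)) := by
    apply hcont.continuousAt.eventually_mem
    apply isOpen_interior.mem_nhds
    simpa using hint
  obtain ⟨e, he, hball⟩ := Metric.eventually_nhds_iff.1 hnhds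
  have h1 := hsub (interior_subset (hball (y := e / 2) (by
    rw [Real.dist_eq, sub_zero, abs_of_pos (by linarith)]; linarith)))
  have h2 := hmin p hp
  simp only [Set.mem_setOf_eq] at h1
  have e1 : c * cross2 s1 s2 (p + (e / 2) • v) = c * cross2 s1 s2 p
      + (c * c) * (e / 2) * ((s2.1 - s1.1) ^ 2 + (s2.2 - s1.2) ^ 2) := by
    simp only [cross2, v, Prod.fst_add, Prod.snd_add, Prod.smul_fst, Prod.smul_snd, smul_eq_mul]
    ring
  rw [e1, hc] at h1
  have hpos : 0 < (s2.1 - s1.1) ^ 2 + (s2.2 - s1.2) ^ 2 := by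
    by_contra hn
    apply hne
    have a1 : (s2.1 - s1.1) = 0 := by nlinarith [sq_nonneg (s2.1 - s1.1), sq_nonneg (s2.2 - s1.2)]
    have a2 : (s2.2 - s1.2) = 0 := by nlinarith [sq_nonneg (s2.1 - s1.1), sq_nonneg (s2.2 - s1.2)]
    ext <;> linarith
  have := mul_pos (half_pos he) hpos
  linarith

/-- For distinct points `s₁, s₂` and a finite nonempty set `P`
contained in one open half-plane bounded by the line through `s₁` and `s₂`,
there is a point `s ∈ P` such that the interior of the triangle `Δ(s₁,s,s₂)`
contains no point of `P`. -/
theorem statement_12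
    (s1 s2 : Pt) (hne : s1 ≠ s2) (P : Finset Pt) (hP : P.Nonempty)
    (hside : (∀ p ∈ P, StrictLeftOf s1 s2 p) ∨ (∀ p ∈ P, StrictRightOf s1 s2 p)) :
    ∃ s ∈ P, ∀ p ∈ P, p ∉ interior (convexHull ℝ ({s1, s, s2} : Set Pt)) := by
  rcases hside with h | h
  · exact aux_tri s1 s2 hne P hP 1 (by norm_num) (fun p hp => by
      have := h p hp
      unfold StrictLeftOf at this; linarith)
  · exact aux_tri s1 s2 hne P hP (-1) (by norm_num) (fun p hp => by
      have := h p hp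
      unfold StrictRightOf at this; linarith)
end
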